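/- arXiv:2012.14247 — 2 statements merged into one kernel-verified Lean document; each statement's English description precedes it below -/
import Mathlib

section
/- (Pólya, 1918, second part) Let f : (0,1) → ℝ be positive and strictly increasing on (0,1), with f integrable on (0,1), and let V(z) = ∫_0^1 sin(z·t)·f(t) dt for z ∈ ℂ. Then every zero of V is simple (i.e. if V(z₀) = 0 then V'(z₀) ≠ 0), every positive real zero of V lies in one of the intervals (kπ, (k+1)π) with k = 1, 2, …, and each such interval contains exactly one zero of V. -/
open Complex in
lemma pz_sq_ne {z : ℂ} (hz : Complex.sin z ≠ 0) (n : ℤ) : (((Real.pi * n : ℝ) : ℂ))^2 - z^2 ≠ 0 := by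
  intro h
  apply hz
  have h2 : (z - ((Real.pi * n : ℝ) : ℂ)) * (z + ((Real.pi * n : ℝ) : ℂ)) = 0 := by linear_combination -h
  rw [Complex.sin_eq_zero_iff]
  rcases mul_eq_zero.1 h2 with h3 | h3
  · exact ⟨n, by push_cast at h3; linear_combination h3⟩
  · exact ⟨-n, by push_cast at h3 ⊢; linear_combination h3⟩

open Complex in
lemma pz_exp (n : ℤ) : Complex.exp (((Real.pi * n : ℝ) : ℂ) * I) = (-1)^n := by
  have : ((Real.pi * n : ℝ) : ℂ) * I = n * (Real.pi * I) := by push_cast; ring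
  rw [this, Complex.exp_int_mul, Complex.exp_pi_mul_I]

open Complex in
lemma pz_exp' (n : ℤ) : Complex.exp (-(((Real.pi * n : ℝ) : ℂ) * I)) = (-1)^n := by
  rw [Complex.exp_neg, pz_exp]
  rcases Int.even_or_odd n with h | h
  · simp [h.neg_one_zpow]
  · simp [h.neg_one_zpow]

open Complex in
lemma pz_coef {z : ℂ} (hz : Complex.sin z ≠ 0) (n : ℤ) :
    ∫ t in (-1:ℝ)..1, Complex.exp (-(((Real.pi * n : ℝ) : ℂ) * I) * t) *
      (Complex.sin (z * t) - t * Complex.sin z) =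
    2 * (z^2 * Complex.sin z * (-1)^n * I /
      (((Real.pi * n : ℝ) : ℂ) * ((((Real.pi * n : ℝ) : ℂ))^2 - z^2))) := by
  have hz0 : z ≠ 0 := by rintro rfl; simp at hz
  rcases eq_or_ne n 0 with rfl | hn
  · have : ∀ t ∈ Set.uIcc (-1:ℝ) 1, HasDerivAt (fun t : ℝ => -Complex.cos (z * t) / z - (t:ℂ)^2/2 * Complex.sin z)
        (Complex.exp (-(((Real.pi * (0:ℤ) : ℝ) : ℂ) * I) * t) *
      (Complex.sin (z * t) - t * Complex.sin z)) t := by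
      intro t _
      have h0 := hasDerivAt_id' (t:ℂ)
      have h1 := (((h0.const_mul z).ccos.neg).div_const z).sub (((h0.pow 2).div_const 2).mul_const (Complex.sin z))
      convert! h1.comp_ofReal using 1
      simp
      field_simp
    rw [intervalIntegral.integral_eq_sub_of_hasDerivAt this (by apply Continuous.intervalIntegrable; fun_prop)]
    simp
  · set a : ℂ := ((Real.pi * n : ℝ) : ℂ) with ha
    have hE := pz_exp n
    have hE' := pz_exp' n
    have ha0 : a ≠ 0 := by simp [ha, hn, Real.pi_ne_zero]
    have hza := pz_sq_ne hz n
    rw [← ha] at hE hE' hza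
    have hza' : z^2 - a^2 ≠ 0 := by intro h; apply hza; linear_combination -h
    have : ∀ t ∈ Set.uIcc (-1:ℝ) 1, HasDerivAt (fun t : ℝ =>
        Complex.exp (-(a * I) * t) * ((-I*a*Complex.sin (z*t) - z * Complex.cos (z*t))/(z^2-a^2)
          - Complex.sin z * (t * (I/a) + 1/a^2)))
        (Complex.exp (-(a * I) * t) *
      (Complex.sin (z * t) - t * Complex.sin z)) t := by
      intro t _
      have h0 := hasDerivAt_id' (t:ℂ)
      have h1 := ((h0.const_mul (-(a * I))).cexp).mul
        (((((h0.const_mul z).csin.const_mul (-I*a)).sub ((h0.const_mul z).ccos.const_mul z)).div_const (z^2-a^2)).sub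
          (((h0.mul_const (I/a)).add_const (1/a^2)).const_mul (Complex.sin z)))
      convert! h1.comp_ofReal using 1
      simp only [Pi.sub_apply]
      field_simp
      have : I^2 = -1 := Complex.I_sq
      linear_combination (-(a * t * Complex.sin z * z^2) - a^3 * Complex.sin (t*z) + a^3 * t * Complex.sin z) * this
    rw [intervalIntegral.integral_eq_sub_of_hasDerivAt this (by apply Continuous.intervalIntegrable; fun_prop)]
    have e1 : -(a*I) * ((1:ℝ):ℂ) = -(a*I) := by simp
    have e2 : -(a*I) * ((-1:ℝ):ℂ) = a*I := by simp
    rw [e1, e2, hE, hE']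
    have e3 : z * ((-1:ℝ):ℂ) = -z := by simp
    have e4 : z * ((1:ℝ):ℂ) = z := by simp
    rw [e3, e4, Complex.sin_neg, Complex.cos_neg]
    push_cast
    field_simp
    ring

open Complex in
lemma pz_summable (z : ℂ) :
    Summable (fun n : ℤ => z^2 * Complex.sin z * (-1)^n * I /
      (((Real.pi * n : ℝ) : ℂ) * ((((Real.pi * n : ℝ) : ℂ))^2 - z^2))) := by
  have hs : Summable (fun n : ℤ => ‖z^2 * Complex.sin z‖ * (1 / (n:ℝ)^2)) :=
    (Real.summable_one_div_int_pow.2 one_lt_two).mul_left _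
  refine Summable.of_norm_bounded_eventually hs ?_
  have hfin : (Set.Icc (-⌈‖z‖^2⌉ : ℤ) ⌈‖z‖^2⌉ ∪ {0}).Finite := (Set.finite_Icc _ _).union (Set.finite_singleton _)
  refine hfin.subset ?_
  intro n hn
  by_contra hcon
  apply hn
  simp only [Set.mem_union, Set.mem_Icc, Set.mem_singleton_iff, not_or, not_and_or, not_le] at hcon
  obtain ⟨h1, h0⟩ := hcon
  have habs : ‖z‖^2 ≤ |(n:ℝ)| := by
    have := Int.le_ceil (‖z‖^2)
    have h2 : (⌈‖z‖^2⌉ : ℝ) ≤ |(n:ℝ)| := by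
      have : ⌈‖z‖^2⌉ ≤ |n| := by
        rcases h1 with h | h
        · have := neg_abs_le n; omega
        · have := le_abs_self n; omega
      exact_mod_cast this
    linarith
  have hn1 : 1 ≤ |(n:ℝ)| := by exact_mod_cast Int.one_le_abs h0
  have hpi := Real.pi_gt_three
  have hlow : |(n:ℝ)| ≤ ‖((((Real.pi * n : ℝ) : ℂ))^2 - z^2)‖ := by
    have := norm_sub_norm_le ((((Real.pi * n : ℝ) : ℂ))^2) (z^2)
    rw [norm_pow, norm_pow, Complex.norm_real, Real.norm_eq_abs, abs_mul, abs_of_pos Real.pi_pos] at this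
    have h9 : 3 * |(n:ℝ)| ≤ Real.pi * |(n:ℝ)| := by nlinarith
    nlinarith
  show ‖_‖ ≤ _
  rw [norm_div, norm_mul, norm_mul (z^2 * Complex.sin z), norm_mul (((Real.pi * n : ℝ) : ℂ))]
  simp only [norm_zpow, norm_neg, norm_one, one_zpow, mul_one, Complex.norm_I]
  rw [div_eq_mul_one_div]
  refine mul_le_mul_of_nonneg_left ?_ (norm_nonneg _)
  refine one_div_le_one_div_of_le (by positivity) ?_
  rw [Complex.norm_real, Real.norm_eq_abs, abs_mul, abs_of_pos Real.pi_pos, ← sq_abs (n:ℝ)]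
  have : |(n:ℝ)| * |(n:ℝ)| ≤ (Real.pi * |(n:ℝ)|) * ‖((((Real.pi * n : ℝ) : ℂ))^2 - z^2)‖ := by
    apply mul_le_mul _ hlow (by positivity) (by positivity)
    nlinarith
  nlinarith

open Complex in
lemma pz_fourier {z : ℂ} (hz : Complex.sin z ≠ 0) {t : ℝ} (ht : t ∈ Set.Ioo (-1:ℝ) 1) :
    HasSum (fun n : ℤ => z^2 * Complex.sin z * (-1)^n * I /
      (((Real.pi * n : ℝ) : ℂ) * ((((Real.pi * n : ℝ) : ℂ))^2 - z^2)) *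
        Complex.exp (((Real.pi * n : ℝ) : ℂ) * t * I)) (Complex.sin (z * t) - t * Complex.sin z) := by
  have : Fact ((0:ℝ) < 2) := ⟨by norm_num⟩
  let g : ℝ → ℂ := fun t => Complex.sin (z * t) - t * Complex.sin z
  have hc : Continuous (AddCircle.liftIco (2:ℝ) (-1) g) := by
    apply AddCircle.liftIco_continuous
    · have : (-1:ℝ) + 2 = 1 := by norm_num
      rw [this]; simp [g]
    · apply Continuous.continuousOn; fun_prop
  let G : C(AddCircle (2:ℝ), ℂ) := ⟨_, hc⟩
  have hco : ∀ n : ℤ, fourierCoeff G n = z^2 * Complex.sin z * (-1)^n * I /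
      (((Real.pi * n : ℝ) : ℂ) * ((((Real.pi * n : ℝ) : ℂ))^2 - z^2)) := by
    intro n
    show fourierCoeff (AddCircle.liftIco (2:ℝ) (-1) g) n = _
    rw [fourierCoeff_liftIco_eq, fourierCoeffOn_eq_integral]
    have h12 : (-1:ℝ) + 2 = 1 := by norm_num
    have := pz_coef hz n
    have h3 : ∫ x in (-1:ℝ)..(-1+2), fourier (-n) (x : AddCircle ((-1+2:ℝ) - (-1))) • g x =
       ∫ t in (-1:ℝ)..1, Complex.exp (-(((Real.pi * n : ℝ) : ℂ) * I) * t) *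
      (Complex.sin (z * t) - t * Complex.sin z) := by
      rw [h12]
      congr 1
      ext x
      rw [fourier_coe_apply]
      simp only [g, smul_eq_mul]
      congr 2
      push_cast
      ring
    rw [h3, this, Complex.real_smul]
    push_cast
    ring
  have hsum : Summable (fourierCoeff G) := by
    rw [show fourierCoeff G = _ from funext hco]
    exact pz_summable z
  have := has_pointwise_sum_fourier_series_of_summable hsum (t : AddCircle (2:ℝ))
  have hGt : G (t : AddCircle (2:ℝ)) = g t := by
    show AddCircle.liftIco (2:ℝ) (-1) g t = _
    exact AddCircle.liftIco_coe_apply ⟨ht.1.le, by linarith [ht.2]⟩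
  rw [hGt] at this
  convert! this using 2 with n
  rw [hco, fourier_coe_apply, smul_eq_mul]
  congr 2
  push_cast
  ring

open Complex in
lemma pz_fourier_sin {z : ℂ} (hz : Complex.sin z ≠ 0) {t : ℝ} (ht : t ∈ Set.Ioo (-1:ℝ) 1) :
    HasSum (fun n : ℤ => z^2 * Complex.sin z * (-1)^n * I /
      (((Real.pi * n : ℝ) : ℂ) * ((((Real.pi * n : ℝ) : ℂ))^2 - z^2)) *
        (I * Complex.sin (((Real.pi * n : ℝ) : ℂ) * t))) (Complex.sin (z * t) - t * Complex.sin z) := by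
  have h1 := pz_fourier hz ht
  have h2 := pz_fourier hz (t := -t) ⟨by linarith [ht.2], by linarith [ht.1]⟩
  have h3 := (h1.sub h2).div_const 2
  convert! h3 using 1
  · ext n
    have e : ((Real.pi * n : ℝ) : ℂ) * ((-t : ℝ):ℂ) * I = (-(((Real.pi * n : ℝ) : ℂ) * t)) * I := by push_cast; ring
    rw [e, Complex.exp_mul_I, Complex.exp_mul_I, Complex.sin_neg, Complex.cos_neg]
    ring
  · simp
    ring
lemma pz_int {f : ℝ → ℝ} (hI : IntervalIntegrable f MeasureTheory.volume 0 1) {g : ℝ → ℝ} (hg : Continuous g)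
    {a b : ℝ} (ha : 0 ≤ a) (hab : a ≤ b) (hb : b ≤ 1) :
    IntervalIntegrable (fun t => g t * f t) MeasureTheory.volume a b := by
  have h := hI.continuousOn_mul (f := f) hg.continuousOn
  refine h.mono_set ?_
  rw [Set.uIcc_of_le hab, Set.uIcc_of_le zero_le_one]
  exact Set.Icc_subset_Icc ha hb

lemma pz_sgn {f : ℝ → ℝ}
    (hpos : ∀ t ∈ Set.Ioo (0:ℝ) 1, 0 < f t)
    (hmono : StrictMonoOn f (Set.Ioo (0:ℝ) 1))
    (hI : IntervalIntegrable f MeasureTheory.volume 0 1) (N : ℕ) (hN : 1 ≤ N) :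
    0 < (-1:ℝ)^(N+1) * ∫ t in (0:ℝ)..1, Real.sin (Real.pi * N * t) * f t := by
  have hN0 : (0:ℝ) < N := by exact_mod_cast hN
  have hpi := Real.pi_pos
  let J : ℕ → ℝ := fun j => ∫ s in (0:ℝ)..(1/N), Real.sin (Real.pi * N * s) * f (s + j/N)
  let S : ℕ → ℝ := fun j => ∫ t in (0:ℝ)..(j/N), Real.sin (Real.pi * N * t) * f t
  have hg : Continuous (fun t => Real.sin (Real.pi * N * t)) := by fun_prop
  have hle : ∀ j : ℕ, j < N → (j:ℝ)/N + 1/N ≤ 1 := by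
    intro j hj
    have : (j:ℝ) + 1 ≤ N := by exact_mod_cast hj
    rw [← add_div, div_le_one hN0]; exact this
  have hsinpos : ∀ s ∈ Set.Ioo (0:ℝ) (1/N), 0 < Real.sin (Real.pi * N * s) := by
    intro s hs
    have h1 : s * N < 1 := by have := hs.2; rwa [lt_div_iff₀ hN0] at this
    apply Real.sin_pos_of_pos_of_lt_pi
    · have := hs.1; positivity
    · nlinarith
  have hJint : ∀ j : ℕ, j < N → IntervalIntegrable (fun s => Real.sin (Real.pi * N * s) * f (s + j/N)) MeasureTheory.volume 0 (1/N) := by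
    intro j hj
    have h1 : IntervalIntegrable f MeasureTheory.volume ((j:ℝ)/N) (j/N + 1/N) := by
      have := pz_int hI (g := fun _ => 1) continuous_const (a := (j:ℝ)/N) (b := j/N+1/N) (by positivity) (by simp) (hle j hj)
      simpa using this
    have h2 := h1.comp_add_right ((j:ℝ)/N)
    simp only [sub_self, add_sub_cancel_left] at h2
    exact h2.continuousOn_mul hg.continuousOn
  have hshift : ∀ j : ℕ, j < N → ∀ s ∈ Set.Ioo (0:ℝ) (1/N), s + (j:ℝ)/N ∈ Set.Ioo (0:ℝ) 1 := by
    intro j hj s hs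
    refine ⟨by have := hs.1; positivity, ?_⟩
    have := hle j hj
    linarith [hs.2]
  have hJpos : ∀ j, j < N → 0 < J j := by
    intro j hj
    apply intervalIntegral.intervalIntegral_pos_of_pos_on (hJint j hj) _ (by positivity)
    intro s hs
    exact mul_pos (hsinpos s hs) (hpos _ (hshift j hj s hs))
  have hJmono : ∀ j, j + 1 < N → J j < J (j+1) := by
    intro j hj
    have h := intervalIntegral.intervalIntegral_pos_of_pos_on (f := fun s => Real.sin (Real.pi * N * s) * f (s + (j+1:ℕ)/N) - Real.sin (Real.pi * N * s) * f (s + j/N))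
      ((hJint (j+1) hj).sub (hJint j (by omega))) ?_ (by positivity : (0:ℝ) < 1/N)
    · rw [intervalIntegral.integral_sub (hJint (j+1) hj) (hJint j (by omega))] at h
      exact sub_pos.1 h
    · intro s hs
      have h1 := hmono (hshift j (by omega) s hs) (hshift (j+1) hj s hs) (by gcongr; simp)
      have := mul_lt_mul_of_pos_left h1 (hsinpos s hs)
      linarith
  have hSrec : ∀ j, j < N → S (j+1) = S j + (-1)^j * J j := by
    intro j hj
    have e1 : ((j+1:ℕ):ℝ)/N = j/N + 1/N := by push_cast; ring
    have h1 := hle j hj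
    have hp : (0:ℝ) ≤ j/N := by positivity
    have hp1 : (0:ℝ) ≤ 1/N := by positivity
    show ∫ t in (0:ℝ)..((j+1:ℕ)/N), Real.sin (Real.pi * N * t) * f t = _
    rw [e1, ← intervalIntegral.integral_add_adjacent_intervals (b := (j:ℝ)/N)
      (pz_int hI hg le_rfl hp (by linarith)) (pz_int hI hg hp (by linarith) h1)]
    congr 1
    have := intervalIntegral.integral_comp_add_right (a := 0) (b := 1/(N:ℝ)) (fun t => Real.sin (Real.pi * N * t) * f t) ((j:ℝ)/N)
    rw [zero_add, add_comm (1/(N:ℝ))] at this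
    rw [← this, ← intervalIntegral.integral_const_mul]
    congr 1
    ext s
    have : Real.pi * N * (s + j/N) = Real.pi * N * s + j * Real.pi := by field_simp
    rw [this, Real.sin_add_nat_mul_pi]
    ring
  have key : ∀ j, j < N → 0 < (-1)^j * S (j+1) ∧ (-1)^j * S (j+1) ≤ J j := by
    intro j
    induction j with
    | zero =>
      intro h
      have : S 0 = 0 := by simp [S]
      rw [hSrec 0 h, this]
      simpa using hJpos 0 h
    | succ j ih =>
      intro h
      obtain ⟨i1, i2⟩ := ih (by omega)
      have hsq : ((-1:ℝ)^(j+1)) * (-1)^(j+1) = 1 := by rw [← mul_pow]; simp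
      have e : (-1)^(j+1) * S (j+1+1) = J (j+1) - (-1)^j * S (j+1) := by
        rw [hSrec (j+1) h, mul_add, ← mul_assoc, hsq, pow_succ]; ring
      have := hJmono j h
      rw [e]
      constructor <;> linarith
  obtain ⟨M, rfl⟩ : ∃ M, N = M + 1 := ⟨N-1, by omega⟩
  have := (key M (by omega)).1
  have e : S (M+1) = ∫ t in (0:ℝ)..1, Real.sin (Real.pi * (M+1:ℕ) * t) * f t := by
    simp only [S]
    rw [div_self hN0.ne']
  rw [e] at this
  rw [pow_succ, pow_succ]
  simpa using this

lemma pz_A {f : ℝ → ℝ}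
    (hpos : ∀ t ∈ Set.Ioo (0:ℝ) 1, 0 < f t)
    (hI : IntervalIntegrable f MeasureTheory.volume 0 1) : 0 < ∫ t in (0:ℝ)..1, t * f t :=
  intervalIntegral.intervalIntegral_pos_of_pos_on (pz_int hI continuous_id le_rfl zero_le_one le_rfl)
    (fun t ht => mul_pos ht.1 (hpos t ht)) one_pos

/-- Coefficients. -/
noncomputable def pzb (f : ℝ → ℝ) (n : ℤ) : ℝ :=
  (-1)^(n+1) * (∫ t in (0:ℝ)..1, Real.sin (Real.pi * n * t) * f t) / (Real.pi * n)

lemma pzb_pos {f : ℝ → ℝ}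
    (hpos : ∀ t ∈ Set.Ioo (0:ℝ) 1, 0 < f t)
    (hmono : StrictMonoOn f (Set.Ioo (0:ℝ) 1))
    (hI : IntervalIntegrable f MeasureTheory.volume 0 1) (n : ℤ) (hn : n ≠ 0) : 0 < pzb f n := by
  have hnat : ∀ N : ℕ, 1 ≤ N → 0 < pzb f N := by
    intro N hN
    have h := pz_sgn hpos hmono hI N hN
    have hN0 : (0:ℝ) < N := by exact_mod_cast hN
    unfold pzb
    have e : (-1:ℝ)^((N:ℤ)+1) = (-1)^(N+1) := by exact_mod_cast zpow_natCast (-1:ℝ) (N+1)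
    rw [e]
    have := Real.pi_pos
    push_cast
    positivity
  have hneg : pzb f (-n) = pzb f n := by
    unfold pzb
    have e1 : (-1:ℝ)^(-n+1) = (-1)^(n+1) := by
      rcases Int.even_or_odd n with h | h
      · rw [(h.add_one).neg_one_zpow, (h.neg.add_one).neg_one_zpow]
      · rw [(h.add_one).neg_one_zpow, (h.neg.add_one).neg_one_zpow]
    have e2 : (∫ t in (0:ℝ)..1, Real.sin (Real.pi * (-n:ℤ) * t) * f t) = -∫ t in (0:ℝ)..1, Real.sin (Real.pi * n * t) * f t := by
      rw [← intervalIntegral.integral_neg]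
      congr 1
      ext t
      have : Real.pi * (-n:ℤ) * t = -(Real.pi * n * t) := by push_cast; ring
      rw [this, Real.sin_neg]; ring
    rw [e1, e2]
    push_cast
    rw [mul_neg, mul_neg, neg_div_neg_eq]
  rcases lt_or_gt_of_ne hn with h | h
  · rw [← hneg]
    have := hnat (-n).toNat (by omega)
    rwa [Int.toNat_of_nonneg (by omega)] at this
  · have := hnat n.toNat (by omega)
    rwa [Int.toNat_of_nonneg (by omega)] at this

lemma pzb_zero (f : ℝ → ℝ) : pzb f 0 = 0 := by simp [pzb]

lemma pzb_nonneg {f : ℝ → ℝ}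
    (hpos : ∀ t ∈ Set.Ioo (0:ℝ) 1, 0 < f t)
    (hmono : StrictMonoOn f (Set.Ioo (0:ℝ) 1))
    (hI : IntervalIntegrable f MeasureTheory.volume 0 1) (n : ℤ) : 0 ≤ pzb f n := by
  rcases eq_or_ne n 0 with rfl | h
  · rw [pzb_zero]
  · exact (pzb_pos hpos hmono hI n h).le

open Complex in
lemma pz_expand {f : ℝ → ℝ}
    (hI : IntervalIntegrable f MeasureTheory.volume 0 1) {z : ℂ} (hz : Complex.sin z ≠ 0) :
    HasSum (fun n : ℤ => (pzb f n : ℂ) * (z^2 / ((((Real.pi * n : ℝ) : ℂ))^2 - z^2)))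
      ((∫ t in (0:ℝ)..1, Complex.sin (z * (t : ℂ)) * ((f t : ℝ) : ℂ)) / Complex.sin z
        - ((∫ t in (0:ℝ)..1, t * f t : ℝ) : ℂ)) := by
  set c : ℤ → ℂ := fun n => z^2 * Complex.sin z * (-1)^n * I /
      (((Real.pi * n : ℝ) : ℂ) * ((((Real.pi * n : ℝ) : ℂ))^2 - z^2)) with hc
  have hcs : Summable (fun n => ‖c n‖) := (pz_summable z).norm
  have hIc : IntervalIntegrable (fun t => ((f t : ℝ) : ℂ)) MeasureTheory.volume 0 1 := ⟨hI.1.ofReal, hI.2.ofReal⟩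
  have hmain : HasSum (fun n => ∫ t in (0:ℝ)..1, (c n * (I * Complex.sin (((Real.pi * n : ℝ) : ℂ) * t))) * ((f t : ℝ) : ℂ))
      (∫ t in (0:ℝ)..1, (Complex.sin (z * t) - t * Complex.sin z) * ((f t : ℝ) : ℂ)) := by
    refine intervalIntegral.hasSum_integral_of_dominated_convergence (fun n t => ‖c n‖ * |f t|) ?_ ?_ ?_ ?_ ?_
    · intro n
      have : IntervalIntegrable (fun t => (c n * (I * Complex.sin (((Real.pi * n : ℝ) : ℂ) * t))) * ((f t : ℝ) : ℂ)) MeasureTheory.volume 0 1 :=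
        hIc.continuousOn_mul (by apply Continuous.continuousOn; fun_prop)
      exact this.aestronglyMeasurable_restrict_uIoc
    · intro n
      refine Filter.Eventually.of_forall fun t _ => ?_
      rw [norm_mul, norm_mul, norm_mul, Complex.norm_I, one_mul, Complex.norm_real, Real.norm_eq_abs]
      have : ‖Complex.sin (((Real.pi * n : ℝ) : ℂ) * t)‖ ≤ 1 := by
        rw [← Complex.ofReal_mul, ← Complex.ofReal_sin, Complex.norm_real]
        exact Real.abs_sin_le_one _
      have := mul_le_mul_of_nonneg_left this (norm_nonneg (c n))
      rw [mul_one] at this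
      exact mul_le_mul_of_nonneg_right this (abs_nonneg _)
    · exact Filter.Eventually.of_forall fun t _ => hcs.mul_right _
    · simp_rw [tsum_mul_right]
      exact hI.abs.const_mul _
    · have h1 : ({1}ᶜ : Set ℝ) ∈ MeasureTheory.ae MeasureTheory.volume :=
        MeasureTheory.compl_mem_ae_iff.2 (MeasureTheory.measure_singleton (1:ℝ))
      filter_upwards [h1] with t ht1 ht
      rw [Set.uIoc_of_le zero_le_one] at ht
      have : t < 1 := lt_of_le_of_ne ht.2 ht1
      exact (pz_fourier_sin hz ⟨by linarith [ht.1], this⟩).mul_right _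
  have hfin := hmain.div_const (Complex.sin z)
  convert! hfin using 1
  · ext n
    have e1 : (∫ t in (0:ℝ)..1, (c n * (I * Complex.sin (((Real.pi * n : ℝ) : ℂ) * t))) * ((f t : ℝ) : ℂ))
      = c n * I * ((∫ t in (0:ℝ)..1, Real.sin (Real.pi * n * t) * f t : ℝ) : ℂ) := by
      rw [← intervalIntegral.integral_ofReal, ← intervalIntegral.integral_const_mul]
      congr 1
      ext t
      push_cast
      ring
    rw [e1, hc]
    have hza := pz_sq_ne hz n
    unfold pzb
    rcases eq_or_ne n 0 with rfl | hn
    · simp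
    have hn' : (n:ℂ) ≠ 0 := by exact_mod_cast hn
    have hp : (Real.pi : ℂ) ≠ 0 := by exact_mod_cast Real.pi_ne_zero
    rw [zpow_add₀ (by norm_num)]
    push_cast at hza ⊢
    field_simp
    rw [I_sq]
    ring
  · have e2 : (∫ t in (0:ℝ)..1, (Complex.sin (z * t) - t * Complex.sin z) * ((f t : ℝ) : ℂ)) =
      (∫ t in (0:ℝ)..1, Complex.sin (z * (t : ℂ)) * ((f t : ℝ) : ℂ)) - Complex.sin z * ((∫ t in (0:ℝ)..1, t * f t : ℝ) : ℂ) := by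
      rw [← intervalIntegral.integral_ofReal, ← intervalIntegral.integral_const_mul, ← intervalIntegral.integral_sub]
      · congr 1
        ext t
        push_cast
        ring
      · exact hIc.continuousOn_mul (by apply Continuous.continuousOn; fun_prop)
      · apply IntervalIntegrable.const_mul
        simp only [Complex.ofReal_mul]
        exact hIc.continuousOn_mul (by apply Continuous.continuousOn; fun_prop)
    rw [e2]
    field_simp

open Complex in
lemma pz_expand_real {f : ℝ → ℝ}
    (hI : IntervalIntegrable f MeasureTheory.volume 0 1) {x : ℝ} (hx : Real.sin x ≠ 0) :
    HasSum (fun n : ℤ => pzb f n * (x^2 / ((Real.pi * n)^2 - x^2)))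
      ((∫ t in (0:ℝ)..1, Real.sin (x * t) * f t) / Real.sin x - (∫ t in (0:ℝ)..1, t * f t)) := by
  have hx' : Complex.sin (x:ℂ) ≠ 0 := by rw [← Complex.ofReal_sin]; exact_mod_cast hx
  have h := pz_expand hI hx'
  rw [← Complex.hasSum_ofReal]
  convert! h using 1
  · ext n; push_cast; rfl
  · push_cast
    rw [← intervalIntegral.integral_ofReal]
    push_cast
    rfl

open Complex in
lemma pz_deriv {f : ℝ → ℝ}
    (hI : IntervalIntegrable f MeasureTheory.volume 0 1) (z : ℂ) :
    HasDerivAt (fun z : ℂ => ∫ t in (0:ℝ)..1, Complex.sin (z * (t : ℂ)) * ((f t : ℝ) : ℂ))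
      (∫ t in (0:ℝ)..1, (Complex.cos (z * (t : ℂ)) * t) * ((f t : ℝ) : ℂ)) z := by
  have hIc : IntervalIntegrable (fun t => ((f t : ℝ) : ℂ)) MeasureTheory.volume 0 1 := ⟨hI.1.ofReal, hI.2.ofReal⟩
  have hint : ∀ w : ℂ, IntervalIntegrable (fun t : ℝ => Complex.sin (w * (t : ℂ)) * ((f t : ℝ) : ℂ)) MeasureTheory.volume 0 1 :=
    fun w => hIc.continuousOn_mul (by apply Continuous.continuousOn; fun_prop)
  have hint' : IntervalIntegrable (fun t : ℝ => (Complex.cos (z * (t : ℂ)) * t) * ((f t : ℝ) : ℂ)) MeasureTheory.volume 0 1 :=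
    hIc.continuousOn_mul (by apply Continuous.continuousOn; fun_prop)
  refine (intervalIntegral.hasDerivAt_integral_of_dominated_loc_of_deriv_le
    (F := fun w t => Complex.sin (w * (t : ℂ)) * ((f t : ℝ) : ℂ))
    (F' := fun w t => (Complex.cos (w * (t : ℂ)) * t) * ((f t : ℝ) : ℂ))
    (bound := fun t => Real.exp (‖z‖ + 1) * |f t|)
    (Metric.ball_mem_nhds z one_pos) ?_ (hint z) ?_ ?_ ?_ ?_).2
  · exact Filter.Eventually.of_forall fun w => (hint w).aestronglyMeasurable_restrict_uIoc
  · exact hint'.aestronglyMeasurable_restrict_uIoc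
  · refine Filter.Eventually.of_forall fun t ht w hw => ?_
    rw [Set.uIoc_of_le zero_le_one] at ht
    rw [norm_mul, norm_mul, Complex.norm_real, Complex.norm_real, Real.norm_eq_abs, Real.norm_eq_abs]
    refine mul_le_mul_of_nonneg_right ?_ (abs_nonneg _)
    have hw' : ‖w‖ ≤ ‖z‖ + 1 := by
      have h1 := norm_sub_norm_le w z
      rw [Metric.mem_ball, dist_eq_norm] at hw
      linarith
    have hu : ‖w * t‖ ≤ ‖z‖ + 1 := by
      rw [norm_mul, Complex.norm_real, Real.norm_eq_abs, abs_of_pos ht.1]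
      nlinarith [ht.2, ht.1, norm_nonneg w]
    have hcos : ‖Complex.cos (w * t)‖ ≤ Real.exp (‖z‖ + 1) := by
      rw [Complex.cos, norm_div]
      have h1 := norm_add_le (Complex.exp (w * t * I)) (Complex.exp (-(w*t) * I))
      have h2 := Complex.norm_exp_le_exp_norm (w * t * I)
      have h3 := Complex.norm_exp_le_exp_norm (-(w * t) * I)
      rw [norm_mul, Complex.norm_I, mul_one] at h2 h3
      rw [norm_neg] at h3
      have h4 := Real.exp_le_exp.2 hu
      rw [Complex.norm_ofNat]
      linarith
    rw [abs_of_pos ht.1]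
    have := Real.exp_pos (‖z‖+1)
    nlinarith [ht.2, ht.1, norm_nonneg (Complex.cos (w*t))]
  · exact hI.abs.const_mul _
  · refine Filter.Eventually.of_forall fun t ht w hw => ?_
    have h0 := (((hasDerivAt_id' w).mul_const (t:ℂ)).csin).mul_const ((f t : ℝ) : ℂ)
    simpa using h0

/-- Herglotz type lower bound. -/
lemma pz_lower {f : ℝ → ℝ}
    (hpos : ∀ t ∈ Set.Ioo (0:ℝ) 1, 0 < f t)
    (hmono : StrictMonoOn f (Set.Ioo (0:ℝ) 1))
    (hI : IntervalIntegrable f MeasureTheory.volume 0 1) {z : ℂ} (hz : Complex.sin z ≠ 0) :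
    ‖Complex.sin z‖ * (pzb f 1 * (Real.pi^2 * |(z^2).im| / Complex.normSq ((Real.pi:ℂ)^2 - z^2))) ≤
      ‖∫ t in (0:ℝ)..1, Complex.sin (z * (t : ℂ)) * ((f t : ℝ) : ℂ)‖ := by
  set W := ∫ t in (0:ℝ)..1, Complex.sin (z * (t : ℂ)) * ((f t : ℝ) : ℂ) with hW
  have h := pz_expand hI hz
  rw [← hW] at h
  have him := Complex.hasSum_im h
  have hterm : ∀ n : ℤ, ((pzb f n : ℂ) * (z^2 / ((((Real.pi * n : ℝ) : ℂ))^2 - z^2))).im =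
      (z^2).im * (pzb f n * ((Real.pi * n)^2 / Complex.normSq ((((Real.pi * n : ℝ) : ℂ))^2 - z^2))) := by
    intro n
    have e : ((Real.pi * n : ℝ) : ℂ)^2 = (((Real.pi * n)^2 : ℝ) : ℂ) := by push_cast; ring
    rw [Complex.im_ofReal_mul, Complex.div_im, e, Complex.sub_re, Complex.sub_im, Complex.ofReal_re, Complex.ofReal_im]
    ring
  simp_rw [hterm] at him
  rw [Complex.sub_im, Complex.ofReal_im, sub_zero] at him
  have hs0 : 0 < ‖Complex.sin z‖ := norm_pos_iff.2 hz
  rcases eq_or_ne (z^2).im 0 with h0 | h0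
  · rw [h0]; simp
  have hq := him.div_const (z^2).im
  simp_rw [mul_div_cancel_left₀ _ h0] at hq
  have hq1 := le_hasSum hq 1 (fun n _ => mul_nonneg (pzb_nonneg hpos hmono hI n)
    (div_nonneg (sq_nonneg _) (Complex.normSq_nonneg _)))
  have hb1 := pzb_pos hpos hmono hI 1 one_ne_zero
  simp only [Int.cast_one, mul_one] at hq1
  have hle : pzb f 1 * (Real.pi^2 / Complex.normSq ((Real.pi:ℂ)^2 - z^2)) * |(z^2).im| ≤ |(W / Complex.sin z).im| := by
    have h1 := hq1.trans (le_abs_self _)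
    rw [abs_div, le_div_iff₀ (abs_pos.2 h0)] at h1
    exact h1
  have h2 := hle.trans (Complex.abs_im_le_norm _)
  rw [norm_div, le_div_iff₀ hs0] at h2
  calc _ = _ := by ring
    _ ≤ _ := h2

lemma pz_ne_int {f : ℝ → ℝ}
    (hpos : ∀ t ∈ Set.Ioo (0:ℝ) 1, 0 < f t)
    (hmono : StrictMonoOn f (Set.Ioo (0:ℝ) 1))
    (hI : IntervalIntegrable f MeasureTheory.volume 0 1) (n : ℤ) (hn : n ≠ 0) :
    ∫ t in (0:ℝ)..1, Real.sin (n * Real.pi * t) * f t ≠ 0 := by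
  intro h
  have h1 := pzb_pos hpos hmono hI n hn
  unfold pzb at h1
  rw [mul_comm Real.pi, h] at h1
  simp at h1

lemma pz_real (f : ℝ → ℝ) (x : ℝ) :
    (∫ t in (0:ℝ)..1, Complex.sin ((x:ℂ) * (t : ℂ)) * ((f t : ℝ) : ℂ)) =
      ((∫ t in (0:ℝ)..1, Real.sin (x * t) * f t : ℝ) : ℂ) := by
  rw [← intervalIntegral.integral_ofReal]
  push_cast
  rfl

lemma pz_imag {f : ℝ → ℝ}
    (hpos : ∀ t ∈ Set.Ioo (0:ℝ) 1, 0 < f t)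
    (hI : IntervalIntegrable f MeasureTheory.volume 0 1) {y : ℝ} (hy : y ≠ 0) :
    (∫ t in (0:ℝ)..1, Complex.sin (((y:ℂ) * Complex.I) * (t : ℂ)) * ((f t : ℝ) : ℂ)) ≠ 0 := by
  have e : (∫ t in (0:ℝ)..1, Complex.sin (((y:ℂ) * Complex.I) * (t : ℂ)) * ((f t : ℝ) : ℂ)) =
      Complex.I * ((∫ t in (0:ℝ)..1, Real.sinh (y * t) * f t : ℝ) : ℂ) := by
    rw [← intervalIntegral.integral_ofReal, ← intervalIntegral.integral_const_mul]
    congr 1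
    ext t
    have : (y:ℂ) * Complex.I * t = ((y * t : ℝ) : ℂ) * Complex.I := by push_cast; ring
    rw [this, Complex.sin_mul_I]
    push_cast
    ring
  rw [e]
  refine mul_ne_zero Complex.I_ne_zero ?_
  rw [Complex.ofReal_ne_zero]
  rcases lt_or_gt_of_ne hy with h | h
  · have := intervalIntegral.intervalIntegral_pos_of_pos_on
      (pz_int hI (g := fun t => -Real.sinh (y * t)) (by fun_prop) le_rfl zero_le_one le_rfl)
      (fun t ht => mul_pos (neg_pos.2 (Real.sinh_neg_iff.2 (mul_neg_of_neg_of_pos h ht.1))) (hpos t ht)) one_pos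
    simp only [neg_mul, intervalIntegral.integral_neg] at this
    intro h0
    rw [h0] at this
    simp at this
  · have := intervalIntegral.intervalIntegral_pos_of_pos_on
      (pz_int hI (g := fun t => Real.sinh (y * t)) (by fun_prop) le_rfl zero_le_one le_rfl)
      (fun t ht => mul_pos (Real.sinh_pos_iff.2 (mul_pos h ht.1)) (hpos t ht)) one_pos
    exact this.ne'

open Filter Topology in
lemma pz_simple {f : ℝ → ℝ}
    (hpos : ∀ t ∈ Set.Ioo (0:ℝ) 1, 0 < f t)
    (hmono : StrictMonoOn f (Set.Ioo (0:ℝ) 1))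
    (hI : IntervalIntegrable f MeasureTheory.volume 0 1) {V : ℂ → ℂ}
    (hV : ∀ z : ℂ, V z = ∫ t in (0:ℝ)..1, Complex.sin (z * (t : ℂ)) * ((f t : ℝ) : ℂ))
    (z : ℂ) (hz : V z = 0) : deriv V z ≠ 0 := by
  have hVeq : V = fun z : ℂ => ∫ t in (0:ℝ)..1, Complex.sin (z * (t : ℂ)) * ((f t : ℝ) : ℂ) := funext hV
  have hder := pz_deriv hI z
  rw [← hVeq] at hder
  rcases eq_or_ne z.re 0 with hre | hre
  · have hzI : z = (z.im : ℂ) * Complex.I := by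
      apply Complex.ext <;> simp [hre]
    rcases eq_or_ne z.im 0 with him | him
    · have h0 : z = 0 := by rw [hzI, him]; simp
      rw [hder.deriv, h0]
      have : (∫ t in (0:ℝ)..1, (Complex.cos (0 * (t : ℂ)) * t) * ((f t : ℝ) : ℂ)) = ((∫ t in (0:ℝ)..1, t * f t : ℝ) : ℂ) := by
        rw [← intervalIntegral.integral_ofReal]
        simp
      rw [this, Complex.ofReal_ne_zero]
      exact (pz_A hpos hI).ne'
    · exfalso
      rw [hV, hzI] at hz
      exact pz_imag hpos hI him hz
  have hsin : Complex.sin z ≠ 0 := by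
    intro h
    obtain ⟨n, hn⟩ := Complex.sin_eq_zero_iff.1 h
    have hn' : z = ((n * Real.pi : ℝ) : ℂ) := by rw [hn]; push_cast; rfl
    have hn0 : n ≠ 0 := by
      rintro rfl
      apply hre; rw [hn']; simp
    rw [hV, hn', pz_real, Complex.ofReal_eq_zero] at hz
    exact pz_ne_int hpos hmono hI n hn0 hz
  have hb1 := pzb_pos hpos hmono hI 1 one_ne_zero
  have hden : (Real.pi:ℂ)^2 - z^2 ≠ 0 := by
    have := pz_sq_ne hsin 1
    simpa using this
  have hnsq := Complex.normSq_pos.2 hden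
  have hs0 : 0 < ‖Complex.sin z‖ := norm_pos_iff.2 hsin
  have him : z.im = 0 := by
    by_contra him
    have h := pz_lower hpos hmono hI hsin
    rw [← hV, hz, norm_zero] at h
    have h2 : (z^2).im ≠ 0 := by
      rw [sq, Complex.mul_im]
      have := mul_ne_zero hre him
      intro h; apply this; linarith
    have h3 := abs_pos.2 h2
    have := Real.pi_pos
    have : 0 < ‖Complex.sin z‖ * (pzb f 1 * (Real.pi^2 * |(z^2).im| / Complex.normSq ((Real.pi:ℂ)^2 - z^2))) := by positivity
    linarith
  intro hd
  have hD : HasDerivAt V 0 z := by rw [← hd]; exact hder.differentiableAt.hasDerivAt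
  let p : ℝ → ℂ := fun e => z + (e:ℂ) * Complex.I
  have hp0 : p 0 = z := by simp [p]
  have hpc : Continuous p := by fun_prop
  have hpd : HasDerivAt p Complex.I 0 := by
    have h0 : HasDerivAt (fun t : ℝ => (t:ℂ)) 1 0 := Complex.ofRealCLM.hasDerivAt
    have h1 := (h0.mul_const Complex.I).const_add z
    rw [one_mul] at h1
    exact h1
  have hcomp : HasDerivAt (V ∘ p) (0 * Complex.I) 0 := by
    apply HasDerivAt.comp
    · rw [hp0]; exact hD
    · exact hpd
  rw [zero_mul, hasDerivAt_iff_tendsto_slope] at hcomp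
  have hcomp := hcomp.norm
  rw [norm_zero] at hcomp
  let L : ℝ → ℝ := fun e => ‖Complex.sin (p e)‖ * (pzb f 1 * (Real.pi^2 * |2 * z.re| / Complex.normSq ((Real.pi:ℂ)^2 - (p e)^2)))
  have hLc : ContinuousAt L 0 := by
    have hnc : Continuous (fun e => Complex.normSq ((Real.pi:ℂ)^2 - (p e)^2)) :=
      Complex.continuous_normSq.comp (by fun_prop)
    have hsc : Continuous (fun e => ‖Complex.sin (p e)‖) := by fun_prop
    refine hsc.continuousAt.mul (continuousAt_const.mul (continuousAt_const.div hnc.continuousAt ?_))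
    rw [hp0]; exact hnsq.ne'
  have hLt : Tendsto L (𝓝[≠] 0) (𝓝 (L 0)) := hLc.tendsto.mono_left nhdsWithin_le_nhds
  have hL0 : 0 < L 0 := by
    have := Real.pi_pos
    have h3 : 0 < |2 * z.re| := abs_pos.2 (mul_ne_zero two_ne_zero hre)
    simp only [L, hp0]
    positivity
  have hev : ∀ᶠ e in 𝓝[≠] (0:ℝ), L e ≤ ‖slope (V ∘ p) 0 e‖ := by
    have h1 : ∀ᶠ e in 𝓝 (0:ℝ), Complex.sin (p e) ≠ 0 := by
      have hc : Continuous (fun e => Complex.sin (p e)) := by fun_prop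
      apply hc.continuousAt.eventually_ne
      rw [hp0]; exact hsin
    filter_upwards [h1.filter_mono nhdsWithin_le_nhds, self_mem_nhdsWithin] with e he he0
    have he0' : e ≠ 0 := he0
    have h := pz_lower hpos hmono hI he
    rw [← hV] at h
    have himp : ((p e)^2).im = (2 * z.re) * e := by
      simp [p, sq, him]; ring
    rw [himp, abs_mul (2 * z.re)] at h
    rw [slope_def_module, sub_zero, Function.comp_apply, Function.comp_apply, hp0, hz, sub_zero, norm_smul, norm_inv,
      Real.norm_eq_abs, inv_mul_eq_div, le_div_iff₀ (abs_pos.2 he0')]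
    calc _ = _ := by simp only [L]; ring
      _ ≤ _ := h
  have := le_of_tendsto_of_tendsto hLt hcomp hev
  linarith

lemma pz_sin_ne {k : ℕ} {x : ℝ} (hx : x ∈ Set.Ioo ((k : ℝ) * Real.pi) (((k : ℝ) + 1) * Real.pi)) :
    Real.sin x ≠ 0 := by
  intro h
  obtain ⟨n, hn⟩ := Real.sin_eq_zero_iff.1 h
  rw [← hn] at hx
  have h1 := lt_of_mul_lt_mul_right hx.1 Real.pi_pos.le
  have h2 := lt_of_mul_lt_mul_right hx.2 Real.pi_pos.le
  have h1' : (k:ℤ) < n := by exact_mod_cast h1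
  have h2' : n < (k:ℤ) + 1 := by exact_mod_cast h2
  omega

lemma pz_uniq {f : ℝ → ℝ}
    (hpos : ∀ t ∈ Set.Ioo (0:ℝ) 1, 0 < f t)
    (hmono : StrictMonoOn f (Set.Ioo (0:ℝ) 1))
    (hI : IntervalIntegrable f MeasureTheory.volume 0 1) {k : ℕ} {x y : ℝ}
    (hx : x ∈ Set.Ioo ((k : ℝ) * Real.pi) (((k : ℝ) + 1) * Real.pi))
    (hy : y ∈ Set.Ioo ((k : ℝ) * Real.pi) (((k : ℝ) + 1) * Real.pi)) (hxy : x < y)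
    (hx0 : ∫ t in (0:ℝ)..1, Real.sin (x * t) * f t = 0)
    (hy0 : ∫ t in (0:ℝ)..1, Real.sin (y * t) * f t = 0) : False := by
  have h1 := pz_expand_real hI (pz_sin_ne hx)
  have h2 := pz_expand_real hI (pz_sin_ne hy)
  rw [hx0, zero_div] at h1
  rw [hy0, zero_div] at h2
  have hpi := Real.pi_pos
  have hk : (0:ℝ) ≤ k * Real.pi := by positivity
  have hlt : ∀ n : ℤ, n ≠ 0 → pzb f n * (x^2 / ((Real.pi * n)^2 - x^2)) < pzb f n * (y^2 / ((Real.pi * n)^2 - y^2)) := by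
    intro n hn
    refine mul_lt_mul_of_pos_left ?_ (pzb_pos hpos hmono hI n hn)
    have hprod : 0 < ((Real.pi * n)^2 - x^2) * ((Real.pi * n)^2 - y^2) := by
      rw [← sq_abs (Real.pi * n), abs_mul, abs_of_pos hpi]
      rcases le_or_gt |n| (k:ℤ) with h | h
      · have h' : |(n:ℝ)| ≤ k := by exact_mod_cast h
        have h3 : Real.pi * |(n:ℝ)| ≤ k * Real.pi := by nlinarith
        have h4 : 0 ≤ Real.pi * |(n:ℝ)| := by positivity
        apply mul_pos_of_neg_of_neg
        · nlinarith [hx.1]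
        · nlinarith [hy.1]
      · have h' : (k:ℝ) + 1 ≤ |(n:ℝ)| := by exact_mod_cast h
        have h3 : (k+1) * Real.pi ≤ Real.pi * |(n:ℝ)| := by nlinarith
        apply mul_pos
        · nlinarith [hx.1, hx.2]
        · nlinarith [hy.1, hy.2]
    have hxn := left_ne_zero_of_mul hprod.ne'
    have hyn := right_ne_zero_of_mul hprod.ne'
    rw [← sub_pos]
    have e : y^2 / ((Real.pi * n)^2 - y^2) - x^2 / ((Real.pi * n)^2 - x^2) =
        (Real.pi * n)^2 * (y^2 - x^2) / (((Real.pi * n)^2 - x^2) * ((Real.pi * n)^2 - y^2)) := by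
      rw [div_sub_div _ _ hyn hxn]
      congr 1 <;> ring
    rw [e]
    have hn' : (n:ℝ) ≠ 0 := by exact_mod_cast hn
    have : 0 < y^2 - x^2 := by nlinarith [hx.1]
    positivity
  have := hasSum_lt (i := (1:ℤ)) (fun n => ?_) (hlt 1 one_ne_zero) h1 h2
  · exact lt_irrefl _ this
  · rcases eq_or_ne n 0 with rfl | hn
    · simp [pzb_zero]
    · exact (hlt n hn).le

/-- (Pólya, 1918, second part) If `f` is positive and strictly increasing on `(0,1)` and
integrable, then every zero of `V(z) = ∫_0^1 sin(z t) f(t) dt` is simple, every positive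
real zero lies in some interval `(kπ, (k+1)π)` with `k ≥ 1`, and each such interval
contains exactly one zero of `V`. -/
theorem polya_zeros_simple_and_localized (f : ℝ → ℝ)
    (hpos : ∀ t ∈ Set.Ioo (0:ℝ) 1, 0 < f t)
    (hmono : StrictMonoOn f (Set.Ioo (0:ℝ) 1))
    (hint : MeasureTheory.IntegrableOn f (Set.Ioo (0:ℝ) 1))
    (V : ℂ → ℂ)
    (hV : ∀ z : ℂ, V z = ∫ t in (0:ℝ)..1, Complex.sin (z * (t : ℂ)) * ((f t : ℝ) : ℂ)) :
    (∀ z₀ : ℂ, V z₀ = 0 → deriv V z₀ ≠ 0) ∧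
    (∀ x : ℝ, 0 < x → V (x : ℂ) = 0 →
      ∃ k : ℕ, 1 ≤ k ∧ x ∈ Set.Ioo ((k : ℝ) * Real.pi) (((k : ℝ) + 1) * Real.pi)) ∧
    (∀ k : ℕ, 1 ≤ k →
      ∃! x : ℝ, x ∈ Set.Ioo ((k : ℝ) * Real.pi) (((k : ℝ) + 1) * Real.pi) ∧ V (x : ℂ) = 0) := by
  have hI : IntervalIntegrable f MeasureTheory.volume 0 1 :=
    (intervalIntegrable_iff_integrableOn_Ioo_of_le zero_le_one).2 hint
  have hpi := Real.pi_pos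
  have hVr : ∀ x : ℝ, V (x:ℂ) = ((∫ t in (0:ℝ)..1, Real.sin (x * t) * f t : ℝ) : ℂ) := by
    intro x; rw [hV, pz_real]
  have hVz : ∀ x : ℝ, V (x:ℂ) = 0 ↔ ∫ t in (0:ℝ)..1, Real.sin (x * t) * f t = 0 := by
    intro x; rw [hVr, Complex.ofReal_eq_zero]
  refine ⟨pz_simple hpos hmono hI hV, ?_, ?_⟩
  · intro x hx0 hx
    rw [hVz] at hx
    have hnot : ∀ n : ℕ, x ≠ n * Real.pi := by
      intro n hn
      have hn0 : (n:ℤ) ≠ 0 := by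
        intro h
        have : n = 0 := by exact_mod_cast h
        rw [hn, this] at hx0
        simp at hx0
      rw [hn] at hx
      have := pz_ne_int hpos hmono hI n hn0
      push_cast at this
      exact this hx
    have hdiv : 0 ≤ x / Real.pi := by positivity
    have h1 := Nat.floor_le hdiv
    have h2 := Nat.lt_floor_add_one (x / Real.pi)
    rw [le_div_iff₀ hpi] at h1
    rw [div_lt_iff₀ hpi] at h2
    have hmem : x ∈ Set.Ioo ((⌊x / Real.pi⌋₊ : ℝ) * Real.pi) (((⌊x / Real.pi⌋₊ : ℝ) + 1) * Real.pi) :=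
      ⟨lt_of_le_of_ne h1 (hnot _).symm, h2⟩
    refine ⟨⌊x / Real.pi⌋₊, ?_, hmem⟩
    by_contra hk
    have hk0 : ⌊x / Real.pi⌋₊ = 0 := by omega
    have hs := pz_expand_real hI (pz_sin_ne hmem)
    rw [hk0] at hmem
    simp only [Nat.cast_zero, zero_add, one_mul] at hmem
    rw [hx, zero_div] at hs
    have hnn := hs.nonneg (fun n => ?_)
    · have := pz_A hpos hI
      linarith
    · rcases eq_or_ne n 0 with rfl | hn
      · simp [pzb_zero]
      · have hb := pzb_pos hpos hmono hI n hn
        have hn1 : 1 ≤ |(n:ℝ)| := by exact_mod_cast Int.one_le_abs hn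
        have : 0 ≤ (Real.pi * n)^2 - x^2 := by
          rw [← sq_abs (Real.pi * n), abs_mul, abs_of_pos hpi]
          have : Real.pi ≤ Real.pi * |(n:ℝ)| := by nlinarith
          nlinarith [hmem.2]
        positivity
  · intro k hk
    have hcont : Continuous (fun x : ℝ => ∫ t in (0:ℝ)..1, Real.sin (x * t) * f t) := by
      have hVc : Continuous V := by
        rw [continuous_iff_continuousAt]
        intro z
        have := (pz_deriv hI z).continuousAt
        rwa [← show V = _ from funext hV] at this
      have : (fun x : ℝ => ∫ t in (0:ℝ)..1, Real.sin (x * t) * f t) = fun x : ℝ => (V (x:ℂ)).re := by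
        ext x; rw [hVr, Complex.ofReal_re]
      rw [this]
      fun_prop
    have hg : ContinuousOn (fun x : ℝ => (-1)^(k+1) * ∫ t in (0:ℝ)..1, Real.sin (x * t) * f t)
      (Set.Icc ((k : ℝ) * Real.pi) (((k : ℝ) + 1) * Real.pi)) := (continuous_const.mul hcont).continuousOn
    have hiv := intermediate_value_Ioo' (by nlinarith) hg
    have s1 := pz_sgn hpos hmono hI k hk
    have s2 := pz_sgn hpos hmono hI (k+1) (by omega)
    rw [mul_comm Real.pi] at s1 s2
    have h0 : (0:ℝ) ∈ Set.Ioo ((-1)^(k+1) * ∫ t in (0:ℝ)..1, Real.sin (((k:ℝ)+1) * Real.pi * t) * f t)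
       ((-1)^(k+1) * ∫ t in (0:ℝ)..1, Real.sin ((k:ℝ) * Real.pi * t) * f t) := by
      refine ⟨?_, s1⟩
      rw [pow_succ] at s2
      push_cast at s2
      linarith
    obtain ⟨x, hx, hx0⟩ := hiv h0
    have hx0' : ∫ t in (0:ℝ)..1, Real.sin (x * t) * f t = 0 := by
      rcases mul_eq_zero.1 hx0 with h | h
      · exact absurd h (pow_ne_zero _ (by norm_num))
      · exact h
    refine ⟨x, ⟨hx, (hVz x).2 hx0'⟩, ?_⟩
    rintro y ⟨hy, hy0⟩
    rw [hVz] at hy0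
    rcases lt_trichotomy y x with h | h | h
    · exact (pz_uniq hpos hmono hI hy hx h hy0 hx0').elim
    · exact h
    · exact (pz_uniq hpos hmono hI hx hy h hx0' hy0).elim
end

section
/- Let ν be real with |ν| < 1 and let h(w) = Σ_{n≥0} w^n / ( ((3−ν)/2)_n · ((3+ν)/2)_n ), where (x)_n denotes the ascending Pochhammer symbol; h is the generalized hypergeometric function ₁F₂(1; (3−ν)/2, (3+ν)/2; w). Then every zero w₀ of h is a negative real number, is simple (h'(w₀) ≠ 0), and satisfies −π²(k+1)²/4 ≤ w₀ ≤ −π²k²/4 for some integer k ≥ 1. -/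
open Real MeasureTheory


lemma key (ν : ℝ) (hν : |ν| < 1) (q Q : ℝ → ℝ) (hq : Continuous q)
    (hQ : ∀ t, HasDerivAt Q (-q t) t) (Q1 : Q 1 = 0)
    (hnn : ∀ t ∈ Set.Ico (0:ℝ) 1, 0 ≤ Q t) (hpos : ∃ t ∈ Set.Ioo (0:ℝ) 1, 0 < Q t) :
    0 < ∫ θ in (0:ℝ)..(π/2), Real.cos (ν * θ) * q (Real.cos θ) := by
  obtain ⟨hν1, hν2⟩ := abs_lt.mp hν
  have hcont : Continuous fun θ => Real.cos (ν * θ) * q (Real.cos θ) := by fun_prop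
  have hQc : Continuous Q := continuous_iff_continuousAt.mpr fun t => (hQ t).continuousAt
  set J : ℝ → ℝ := fun x => ∫ θ in (0:ℝ)..x, Real.cos (ν * θ) * q (Real.cos θ) with hJ
  set G : ℝ → ℝ := fun x => Real.cos (ν * x) / Real.sin x * Q (Real.cos x) with hG
  have hJd : ∀ x, HasDerivAt J (Real.cos (ν * x) * q (Real.cos x)) x := fun x =>
    intervalIntegral.integral_hasDerivAt_right (hcont.intervalIntegrable _ _)
      hcont.stronglyMeasurable.stronglyMeasurableAtFilter hcont.continuousAt
  have hsin : ∀ x ∈ Set.Ioc (0:ℝ) (π/2), 0 < Real.sin x := fun x hx =>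
    Real.sin_pos_of_pos_of_lt_pi hx.1 (by linarith [hx.2, Real.pi_pos])
  -- derivative of G
  have hGd : ∀ x ∈ Set.Ioc (0:ℝ) (π/2), HasDerivAt G (Real.cos (ν * x) * q (Real.cos x) -
      (ν * Real.sin (ν * x) * Real.sin x + Real.cos (ν * x) * Real.cos x) / Real.sin x ^ 2
        * Q (Real.cos x)) x := by
    intro x hx
    have h1 : HasDerivAt (fun x => Real.cos (ν * x)) (-Real.sin (ν * x) * ν) x := by
      simpa using ((hasDerivAt_id x).const_mul ν).cos
    have h2 := (hQ (Real.cos x)).comp x (Real.hasDerivAt_cos x)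
    have h3 := (h1.div (Real.hasDerivAt_sin x) (hsin x hx).ne').mul h2
    refine h3.congr_deriv ?_
    have := (hsin x hx).ne'
    simp only [Function.comp, Pi.div_apply]
    field_simp
    ring
  -- continuity of G at 0
  obtain ⟨C, hC⟩ : ∃ C, ∀ t ∈ Set.Icc (0:ℝ) 1, |q t| ≤ C :=
    isCompact_Icc.exists_bound_of_continuousOn hq.continuousOn
  have hCQ : ∀ t ∈ Set.Icc (0:ℝ) 1, |Q t| ≤ C * (1 - t) := by
    intro t ht
    have := (convex_Icc (0:ℝ) 1).norm_image_sub_le_of_norm_hasDerivWithin_le (f := Q) (C := C)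
      (f' := fun t => - q t) (fun t _ => (hQ t).hasDerivWithinAt)
      (fun t ht => by simpa using hC t ht) (Set.right_mem_Icc.mpr zero_le_one) ht
    rw [Q1, sub_zero, Real.norm_eq_abs, Real.norm_eq_abs, abs_sub_comm,
      abs_of_nonneg (by linarith [ht.2] : 0 ≤ 1 - t)] at this
    exact this
  have hC0 : 0 ≤ C := (abs_nonneg _).trans (hC 0 (by simp))
  have hGb : ∀ x ∈ Set.Icc (0:ℝ) (π/2), |G x| ≤ C * Real.sin x := by
    intro x hx
    rcases eq_or_lt_of_le hx.1 with h0 | h0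
    · subst h0; simp [hG]
    have hs := hsin x ⟨h0, hx.2⟩
    have hc : 0 ≤ Real.cos x := Real.cos_nonneg_of_mem_Icc ⟨by linarith [Real.pi_pos], hx.2⟩
    have h1 := hCQ (Real.cos x) ⟨hc, Real.cos_le_one x⟩
    have h2 : |Real.cos (ν * x)| ≤ 1 := Real.abs_cos_le_one _
    simp only [hG]
    rw [abs_mul, abs_div, abs_of_pos hs, div_mul_eq_mul_div, div_le_iff₀ hs]
    have h3 : 1 - Real.cos x ≤ Real.sin x * Real.sin x := by
      nlinarith [Real.sin_sq_add_cos_sq x, Real.cos_le_one x]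
    calc _ ≤ 1 * (C * (1 - Real.cos x)) := by gcongr
      _ ≤ C * Real.sin x * Real.sin x := by nlinarith
  have hGc : ContinuousOn G (Set.Icc 0 (π/2)) := by
    intro x hx
    rcases eq_or_lt_of_le hx.1 with h0 | h0
    · subst h0
      have hG0 : G 0 = 0 := by simp [hG]
      rw [ContinuousWithinAt, hG0]
      refine squeeze_zero_norm' (a := fun x => C * Real.sin x) ?_ ?_
      · filter_upwards [self_mem_nhdsWithin] with y hy using hGb y hy
      · have : Continuous fun x => C * Real.sin x := by fun_prop
        simpa using (this.tendsto 0).mono_left nhdsWithin_le_nhds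
    · exact (hGd x ⟨h0, hx.2⟩).continuousAt.continuousWithinAt
  set H : ℝ → ℝ := fun x => J x - G x with hH
  have hHd : ∀ x ∈ Set.Ioc (0:ℝ) (π/2), HasDerivAt H 
      ((ν * Real.sin (ν * x) * Real.sin x + Real.cos (ν * x) * Real.cos x) / Real.sin x ^ 2
        * Q (Real.cos x)) x := by
    intro x hx
    have h3 := (hJd x).sub (hGd x hx)
    rw [sub_sub_cancel] at h3
    exact h3
  have hHc : ContinuousOn H (Set.Icc 0 (π/2)) := 
    ContinuousOn.sub (fun x _ => (hJd x).continuousAt.continuousWithinAt) hGc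
  have hcoef : ∀ x ∈ Set.Ioo (0:ℝ) (π/2), 
     0 < (ν * Real.sin (ν * x) * Real.sin x + Real.cos (ν * x) * Real.cos x) / Real.sin x ^ 2 := by
    intro x hx
    have hs := hsin x ⟨hx.1, hx.2.le⟩
    have hc : 0 < Real.cos x := Real.cos_pos_of_mem_Ioo ⟨by linarith [Real.pi_pos, hx.1], hx.2⟩
    have hx0 := hx.1
    have hx2 := hx.2
    have hc2 : 0 < Real.cos (ν * x) := Real.cos_pos_of_mem_Ioo ⟨by nlinarith, by nlinarith⟩
    have hνs : 0 ≤ ν * Real.sin (ν * x) := by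
      rcases le_total 0 ν with h | h
      · exact mul_nonneg h (Real.sin_nonneg_of_nonneg_of_le_pi (by positivity) (by nlinarith))
      · exact mul_nonneg_of_nonpos_of_nonpos h
          (Real.sin_nonpos_of_nonpos_of_neg_pi_le (by nlinarith) (by nlinarith))
    positivity
  have hcosm : ∀ x ∈ Set.Ioo (0:ℝ) (π/2), Real.cos x ∈ Set.Ico (0:ℝ) 1 := by
    intro x hx
    have hs := hsin x ⟨hx.1, hx.2.le⟩
    have hc : 0 < Real.cos x := Real.cos_pos_of_mem_Ioo ⟨by linarith [Real.pi_pos, hx.1], hx.2⟩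
    exact ⟨hc.le, by nlinarith [Real.sin_sq_add_cos_sq x]⟩
  have hmono : MonotoneOn H (Set.Icc 0 (π/2)) := by
    apply monotoneOn_of_deriv_nonneg (convex_Icc _ _) hHc
    · rw [interior_Icc]
      exact fun x hx => (hHd x ⟨hx.1, hx.2.le⟩).differentiableAt.differentiableWithinAt
    · rw [interior_Icc]
      intro x hx
      rw [(hHd x ⟨hx.1, hx.2.le⟩).deriv]
      exact mul_nonneg (hcoef x hx).le (hnn _ (hcosm x hx))
  have hpi : (0:ℝ) ≤ π / 2 := by positivity
  have hH0 : H 0 = 0 := by simp [hH, hJ, hG]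
  have hHpi : H (π/2) ≤ J (π/2) := by
    have : 0 ≤ G (π/2) := by
      simp only [hG, Real.cos_pi_div_two, Real.sin_pi_div_two, div_one]
      refine mul_nonneg (Real.cos_nonneg_of_mem_Icc ⟨?_, ?_⟩) (hnn 0 (by simp)) <;> nlinarith [Real.pi_pos]
    simp only [hH]; linarith
  by_contra hcon
  have hle : H (π/2) ≤ 0 := hHpi.trans (not_lt.mp hcon)
  obtain ⟨t, ht, htQ⟩ := hpos
  have hx : Real.arccos t ∈ Set.Ioo (0:ℝ) (π/2) :=
    ⟨Real.arccos_pos.mpr ht.2, Real.arccos_lt_pi_div_two.mpr ht.1⟩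
  have hz : H =ᶠ[nhds (Real.arccos t)] fun _ => 0 := by
    filter_upwards [Ioo_mem_nhds hx.1 hx.2] with y hy
    have hy' : y ∈ Set.Icc (0:ℝ) (π/2) := ⟨hy.1.le, hy.2.le⟩
    have h1 := hmono (Set.left_mem_Icc.mpr hpi) hy' hy'.1
    have h2 := hmono hy' (Set.right_mem_Icc.mpr hpi) hy'.2
    linarith
  have hd := (hHd _ ⟨hx.1, hx.2.le⟩).unique ((hasDerivAt_const _ (0:ℝ)).congr_of_eventuallyEq hz)
  rw [Real.cos_arccos (by linarith [ht.1]) ht.2.le] at hd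
  have := mul_pos (hcoef _ hx) htQ
  rw [Real.cos_arccos (by linarith [ht.1]) ht.2.le] at this
  linarith

/-- positivity in the real case -/
lemma real_case (ν : ℝ) (hν : |ν| < 1) (z : ℝ) (hz : 0 < z) :
    0 < ∫ θ in (0:ℝ)..(π/2), Real.cos (ν * θ) * 
      (Real.cos θ * Real.cos (z * Real.cos θ) * Real.sin z - Real.sin (z * Real.cos θ) * Real.cos z) := by
  set Q : ℝ → ℝ := fun t => ((Real.sin z - t * Real.sin (z * t)) / z - 
    (Real.cos (z * t) - Real.cos z) / z ^ 2) * Real.sin z 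
      - (Real.cos (z * t) - Real.cos z) / z * Real.cos z with hQdef
  have hQ2 : ∀ t, z ^ 2 * Q t = 2 * (Real.sin ((1+t)/2*z) ^ 2 * 
       ((1-t)/2*z - Real.sin ((1-t)/2*z) * Real.cos ((1-t)/2*z)) +
      Real.sin ((1-t)/2*z) ^ 2 * 
       ((1+t)/2*z - Real.sin ((1+t)/2*z) * Real.cos ((1+t)/2*z))) := by
    intro t
    have e1 : z = (1+t)/2*z + (1-t)/2*z := by ring
    have e2 : z * t = (1+t)/2*z - (1-t)/2*z := by ring
    have f1 : Real.sin z = _ := (congrArg Real.sin e1).trans (Real.sin_add _ _)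
    have f2 : Real.cos z = _ := (congrArg Real.cos e1).trans (Real.cos_add _ _)
    have f3 : Real.sin (z*t) = _ := (congrArg Real.sin e2).trans (Real.sin_sub _ _)
    have f4 : Real.cos (z*t) = _ := (congrArg Real.cos e2).trans (Real.cos_sub _ _)
    have : z ^ 2 * Q t = z * (Real.sin z - t * Real.sin (z*t)) * Real.sin z -
        (Real.cos (z * t) - Real.cos z) * Real.sin z - z * Real.cos z * (Real.cos (z * t) - Real.cos z) := by
      simp only [hQdef]; field_simp
    rw [this, f1, f2, f3, f4]
    have g1 := Real.sin_sq_add_cos_sq ((1+t)/2*z)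
    have g2 := Real.sin_sq_add_cos_sq ((1-t)/2*z)
    generalize Real.sin ((1+t)/2*z) = s at *
    generalize Real.cos ((1+t)/2*z) = c at *
    generalize Real.sin ((1-t)/2*z) = S at *
    generalize Real.cos ((1-t)/2*z) = D at *
    have g1' : c^2 = 1 - s^2 := by linarith
    have g2' : D^2 = 1 - S^2 := by linarith
    clear f1 f2 f3 f4 g1 g2 this
    ring_nf
    simp only [g1', g2']
    ring
  have hself : ∀ u : ℝ, 0 < u → 0 < u - Real.sin u * Real.cos u := by
    intro u hu
    have := Real.sin_lt (x := 2 * u) (by positivity)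
    rw [Real.sin_two_mul] at this
    linarith
  refine key ν hν (fun t => t * Real.cos (z * t) * Real.sin z - Real.sin (z * t) * Real.cos z) Q (by fun_prop) ?_ ?_ ?_ ?_
  · intro t
    have h0 : HasDerivAt (fun t => z * t) z t := by simpa using (hasDerivAt_id t).const_mul z
    have hs := h0.sin
    have hc := h0.cos
    have := (((((hasDerivAt_id t).mul hs).const_sub (Real.sin z)).div_const z).sub 
       ((hc.sub_const (Real.cos z)).div_const (z^2))).mul_const (Real.sin z) |>.sub
         (((hc.sub_const (Real.cos z)).div_const z).mul_const (Real.cos z))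
    refine this.congr_deriv ?_
    simp only [id]
    field_simp
    ring
  · simp [hQdef]
  · intro t ht
    have h1 := hself ((1+t)/2*z) (by have := ht.1; positivity)
    have h2 := hself ((1-t)/2*z) (mul_pos (by linarith [ht.2]) hz)
    have : 0 ≤ z^2 * Q t := by rw [hQ2]; positivity
    exact nonneg_of_mul_nonneg_right this (by positivity)
  · have hp := Real.pi_gt_three
    refine ⟨1 - 1/(1+z), ⟨?_, ?_⟩, ?_⟩
    · rw [sub_pos, div_lt_one (by positivity)]; linarith
    · have : 0 < 1/(1+z) := by positivity
      linarith
    · set t := 1 - 1/(1+z) with ht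
      have h01 : 1/(1+z) < 1 := by rw [div_lt_one (by positivity)]; linarith
      have h02 : 0 < 1/(1+z) := by positivity
      have h1 := hself ((1+t)/2*z) (mul_pos (by linarith) hz)
      have h2 := hself ((1-t)/2*z) (mul_pos (by linarith) hz)
      have h3 : 0 < Real.sin ((1-t)/2*z) := by
        apply Real.sin_pos_of_pos_of_lt_pi (mul_pos (by linarith) hz)
        have : (1-t)/2*z = z/(1+z)/2 := by rw [ht]; field_simp; ring
        rw [this]
        have : z/(1+z) < 1 := by rw [div_lt_one (by positivity)]; linarith
        linarith
      have : 0 < z^2 * Q t := by rw [hQ2]; positivity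
      exact pos_of_mul_pos_right this (by positivity)
lemma sinh_aux (x y b : ℝ) (hx : x ≠ 0) (hy : y ≠ 0) (hb : 0 < b) :
    0 < x * y * (x * Real.sinh (2*b*y) - y * Real.sin (2*b*x)) := by
  have h1 : 2*b*y^2 < y * Real.sinh (2*b*y) := by
    rcases lt_or_gt_of_ne hy with h | h
    · have := Real.sinh_lt_self_iff.mpr (by nlinarith : 2*b*y < 0)
      nlinarith
    · have := Real.self_lt_sinh_iff.mpr (by positivity : 0 < 2*b*y)
      nlinarith
  have h2 : x * Real.sin (2*b*x) ≤ 2*b*x^2 := by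
    rcases lt_or_gt_of_ne hx with h | h
    · have := Real.lt_sin (by nlinarith : 2*b*x < 0)
      nlinarith
    · have := Real.sin_lt (by positivity : 0 < 2*b*x)
      nlinarith
  have hx2 : 0 < x^2 := by positivity
  have hy2 : 0 < y^2 := by positivity
  nlinarith

open ComplexConjugate in
lemma sincos_aux (p r : ℝ) : Complex.sin (⟨p, r⟩ : ℂ) * conj (Complex.cos (⟨p, r⟩ : ℂ)) =
    ⟨Real.sin (2*p) / 2, Real.sinh (2*r) / 2⟩ := by
  have e : (⟨p, r⟩ : ℂ) = p + r * Complex.I := by apply Complex.ext <;> simp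
  have g1 := Real.sin_sq_add_cos_sq p
  have g2 := Real.cosh_sq r
  rw [e, Complex.sin_add_mul_I, Complex.cos_add_mul_I, Real.sin_two_mul, Real.sinh_two_mul]
  simp only [← Complex.ofReal_sin, ← Complex.ofReal_cos, ← Complex.ofReal_sinh, ← Complex.ofReal_cosh]
  apply Complex.ext
  · simp [-Complex.ofReal_sin, -Complex.ofReal_cos, -Complex.ofReal_sinh, -Complex.ofReal_cosh]
    linear_combination (Real.sin p * Real.cos p) * g2
  · simp [-Complex.ofReal_sin, -Complex.ofReal_cos, -Complex.ofReal_sinh, -Complex.ofReal_cosh]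
    linear_combination (Real.sinh r * Real.cosh r) * g1

lemma sin_ne (z : ℂ) (hz : z.im ≠ 0) : 0 < Complex.normSq (Complex.sin z) := by
  rw [Complex.normSq_pos]
  intro h
  obtain ⟨k, hk⟩ := Complex.sin_eq_zero_iff.mp h
  apply hz
  rw [hk]
  have : ((k:ℂ) * (π:ℂ)) = ((k * π : ℝ) : ℂ) := by push_cast; rfl
  rw [this, Complex.ofReal_im]

open ComplexConjugate in
lemma complex_case (ν : ℝ) (hν : |ν| < 1) (z : ℂ) (hx : z.re ≠ 0) (hy : z.im ≠ 0) :
    0 < ∫ θ in (0:ℝ)..(π/2), Real.cos (ν * θ) * 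
      (z.re * z.im * (Complex.sin (z * (Real.cos θ : ℝ)) * conj (Complex.sin z)).im) := by
  have hz : z ≠ 0 := by rintro rfl; simp at hx
  set Q : ℝ → ℝ := fun t => z.re * z.im * ((Complex.cos (z * t) - Complex.cos z) / z * conj (Complex.sin z)).im with hQdef
  have hQpos : ∀ t ∈ Set.Ico (0:ℝ) 1, 0 < Q t := by
    intro t ht
    have hb : 0 < (1+t)/2 := by linarith [ht.1]
    have ha : 0 < (1-t)/2 := by linarith [ht.2]
    set u : ℂ := ⟨(1+t)/2*z.re, (1+t)/2*z.im⟩ with hu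
    set v : ℂ := ⟨(1-t)/2*z.re, (1-t)/2*z.im⟩ with hv
    have e1 : z = u + v := by apply Complex.ext <;> simp [hu, hv] <;> ring
    have e2 : z * t = u - v := by apply Complex.ext <;> simp [hu, hv] <;> ring
    have f1 : Complex.sin z = _ := (congrArg Complex.sin e1).trans (Complex.sin_add _ _)
    have f2 : Complex.cos z = _ := (congrArg Complex.cos e1).trans (Complex.cos_add _ _)
    have f4 : Complex.cos (z*t) = _ := (congrArg Complex.cos e2).trans (Complex.cos_sub _ _)
    have g1 := sincos_aux ((1+t)/2*z.re) ((1+t)/2*z.im)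
    have g2 := sincos_aux ((1-t)/2*z.re) ((1-t)/2*z.im)
    have p1 := sinh_aux z.re z.im _ hx hy hb
    have p2 := sinh_aux z.re z.im _ hx hy ha
    have n1 := sin_ne u (by simp only [hu]; exact mul_ne_zero hb.ne' hy)
    have n2 := sin_ne v (by simp only [hv]; exact mul_ne_zero ha.ne' hy)
    have n3 := Complex.normSq_pos.mpr hz
    rw [← hu] at g1
    rw [← hv] at g2
    have key : (Complex.cos (z * t) - Complex.cos z) / z * conj (Complex.sin z) =
       (2 / Complex.normSq z : ℝ) * (conj z * (Complex.normSq (Complex.sin v) * (Complex.sin u * conj (Complex.cos u)) +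
        Complex.normSq (Complex.sin u) * (Complex.sin v * conj (Complex.cos v)))) := by
      rw [f4, f1, f2, div_eq_mul_inv, Complex.inv_def]
      push_cast
      rw [← Complex.mul_conj (Complex.sin v), ← Complex.mul_conj (Complex.sin u)]
      simp only [map_add, map_mul]
      ring
    have hQe : Q t = 2 / Complex.normSq z * (Complex.normSq (Complex.sin v) / 2 * 
         (z.re * z.im * (z.re * Real.sinh (2*((1+t)/2)*z.im) - z.im * Real.sin (2*((1+t)/2)*z.re))) + 
         Complex.normSq (Complex.sin u) / 2 * 
         (z.re * z.im * (z.re * Real.sinh (2*((1-t)/2)*z.im) - z.im * Real.sin (2*((1-t)/2)*z.re)))) := by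
      simp only [hQdef]
      rw [key, g1, g2, Complex.im_ofReal_mul]
      simp only [Complex.mul_im, Complex.mul_re, Complex.add_im, Complex.add_re, Complex.conj_re, Complex.conj_im,
        Complex.ofReal_re, Complex.ofReal_im, mul_assoc]
      ring
    rw [hQe]
    positivity
  refine key ν hν (fun t => z.re * z.im * (Complex.sin (z * (t : ℝ)) * conj (Complex.sin z)).im) Q ?_ ?_ ?_ (fun t ht => (hQpos t ht).le) ?_
  · have : Continuous fun t : ℝ => (Complex.sin (z * (t : ℝ)) * conj (Complex.sin z)) := by fun_prop
    exact continuous_const.mul (Complex.continuous_im.comp this)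
  · intro t
    have h0 : HasDerivAt (fun t : ℂ => z * t) z (t:ℂ) := by
      simpa using (hasDerivAt_id (t:ℂ)).const_mul z
    have hc := h0.ccos.comp_ofReal
    have h1 := (((hc.sub_const (Complex.cos z)).div_const z).mul_const (conj (Complex.sin z)))
    have h2 := (Complex.imCLM.hasFDerivAt.comp_hasDerivAt t h1).const_mul (z.re * z.im)
    refine h2.congr_deriv ?_
    have : -Complex.sin (z * t) * z / z = -Complex.sin (z*t) := by field_simp
    rw [this]
    simp
    ring
  · simp [hQdef]
  · exact ⟨1/2, by norm_num, hQpos _ (by norm_num)⟩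

lemma mom_rec (ν : ℝ) (m : ℕ) :
    (((m:ℝ)+2)^2 - ν^2) * ∫ θ in (0:ℝ)..(π/2), Real.cos (ν*θ) * Real.cos θ ^ (m+2) =
      ((m:ℝ)+2) * (m+1) * ∫ θ in (0:ℝ)..(π/2), Real.cos (ν*θ) * Real.cos θ ^ m := by
  have hE : ∀ θ : ℝ, HasDerivAt (fun θ => -((m:ℝ)+2) * (Real.cos θ ^ (m+1) * Real.sin θ * Real.cos (ν*θ)) +
      ν * (Real.cos θ ^ (m+2) * Real.sin (ν*θ))) 
      (((m:ℝ)+2) * (m+1) * (Real.cos (ν*θ) * Real.cos θ ^ m) - 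
        (((m:ℝ)+2)^2 - ν^2) * (Real.cos (ν*θ) * Real.cos θ ^ (m+2))) θ := by
    intro θ
    have h0 : HasDerivAt (fun t => ν * t) ν θ := by simpa using (hasDerivAt_id θ).const_mul ν
    have hc := Real.hasDerivAt_cos θ
    have := ((((hc.pow (m+1)).mul (Real.hasDerivAt_sin θ)).mul h0.cos).const_mul (-((m:ℝ)+2))).add
      (((hc.pow (m+2)).mul h0.sin).const_mul ν)
    refine this.congr_deriv ?_
    simp only [Pi.pow_apply, Pi.mul_apply]
    push_cast
    have e : Real.sin θ ^ 2 = 1 - Real.cos θ ^ 2 := by linarith [Real.sin_sq_add_cos_sq θ]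
    linear_combination (((m:ℝ)+2) * (m+1) * Real.cos θ ^ m * Real.cos (ν*θ)) * e
  have hi : ∀ k : ℕ, IntervalIntegrable (fun θ => Real.cos (ν*θ) * Real.cos θ ^ k) volume 0 (π/2) := by
    intro k
    apply Continuous.intervalIntegrable
    fun_prop
  have := intervalIntegral.integral_eq_sub_of_hasDerivAt (a := 0) (b := π/2) (fun θ _ => hE θ)
    (((hi m).const_mul _).sub ((hi (m+2)).const_mul _))
  rw [intervalIntegral.integral_sub ((hi m).const_mul _) ((hi (m+2)).const_mul _),
    intervalIntegral.integral_const_mul, intervalIntegral.integral_const_mul] at this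
  simp at this
  linarith

lemma poch_pos (a : ℝ) (ha : 0 < a) (n : ℕ) : 0 < Polynomial.eval a (ascPochhammer ℝ n) :=
  ascPochhammer_pos n a ha

lemma mom (ν : ℝ) (n : ℕ) :
    4^n * (Polynomial.eval ((3-ν)/2) (ascPochhammer ℝ n) * Polynomial.eval ((3+ν)/2) (ascPochhammer ℝ n)) *
      ∫ θ in (0:ℝ)..(π/2), Real.cos (ν*θ) * Real.cos θ ^ (2*n+1) = 
     (2*n+1).factorial * ∫ θ in (0:ℝ)..(π/2), Real.cos (ν*θ) * Real.cos θ := by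
  induction n with
  | zero => simp
  | succ n ih =>
    have h := mom_rec ν (2*n+1)
    rw [ascPochhammer_succ_eval, ascPochhammer_succ_eval, show 2*(n+1)+1 = (2*n+1)+2 from by ring,
      Nat.factorial_succ, Nat.factorial_succ]
    push_cast at h ⊢
    linear_combination (2*(n:ℝ)+3)*(2*n+2) * ih + 4^n * (Polynomial.eval ((3-ν)/2) (ascPochhammer ℝ n) * Polynomial.eval ((3+ν)/2) (ascPochhammer ℝ n)) * h

lemma I1_pos (ν : ℝ) (hν : |ν| < 1) : 0 < ∫ θ in (0:ℝ)..(π/2), Real.cos (ν*θ) * Real.cos θ := by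
  obtain ⟨hν1, hν2⟩ := abs_lt.mp hν
  apply intervalIntegral.intervalIntegral_pos_of_pos_on
  · apply Continuous.intervalIntegrable
    fun_prop
  · intro x hx
    have h1 := hx.1
    have h2 := hx.2
    exact mul_pos (Real.cos_pos_of_mem_Ioo ⟨by nlinarith, by nlinarith⟩)
      (Real.cos_pos_of_mem_Ioo ⟨by linarith, by linarith⟩)
  · positivity

lemma eval_cast (a : ℝ) (n : ℕ) : Polynomial.eval (a:ℂ) (ascPochhammer ℂ n) = 
    ((Polynomial.eval a (ascPochhammer ℝ n) : ℝ) : ℂ) := by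
  induction n with
  | zero => simp
  | succ n ih => rw [ascPochhammer_succ_eval, ascPochhammer_succ_eval, ih]; push_cast; rfl

lemma rep (ν : ℝ) (hν : |ν| < 1) (h : ℂ → ℂ)
    (hh : ∀ w : ℂ, HasSum
      (fun n : ℕ => w ^ n /
        ((Polynomial.eval ((((3 - ν) / 2 : ℝ)) : ℂ) (ascPochhammer ℂ n)) *
         (Polynomial.eval ((((3 + ν) / 2 : ℝ)) : ℂ) (ascPochhammer ℂ n))))
      (h w)) (z : ℂ) :
    ((∫ θ in (0:ℝ)..(π/2), Real.cos (ν*θ) * Real.cos θ : ℝ) : ℂ) * z * h (-z^2/4) =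
     ∫ θ in (0:ℝ)..(π/2), (Real.cos (ν * θ) : ℂ) * Complex.sin (z * (Real.cos θ : ℝ)) := by
  obtain ⟨hν1, hν2⟩ := abs_lt.mp hν
  have h1 := (hh (-z^2/4)).mul_left (((∫ θ in (0:ℝ)..(π/2), Real.cos (ν*θ) * Real.cos θ : ℝ) : ℂ) * z)
  have hsum : Summable fun n : ℕ => ‖z‖ ^ (2*n+1) / ((2*n+1).factorial : ℝ) :=
    (Real.summable_pow_div_factorial ‖z‖).comp_injective (i := fun n : ℕ => 2*n+1) (fun a b hab => by simpa using hab)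
  have h2 := intervalIntegral.hasSum_integral_of_dominated_convergence (a := 0) (b := π/2) (μ := volume)
    (f := fun θ : ℝ => (Real.cos (ν * θ) : ℂ) * Complex.sin (z * (Real.cos θ : ℝ)))
    (F := fun (n : ℕ) (θ : ℝ) => (Real.cos (ν * θ) : ℂ) * ((-1)^n * (z * (Real.cos θ : ℝ))^(2*n+1) / ((2*n+1).factorial : ℂ)))
    (fun n _ => ‖z‖ ^ (2*n+1) / ((2*n+1).factorial : ℝ))
    (fun n => by
      apply Continuous.aestronglyMeasurable
      fun_prop)
    (fun n => Filter.Eventually.of_forall fun θ _ => by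
      rw [norm_mul, norm_div, norm_mul, norm_pow, norm_pow, norm_mul, norm_neg, norm_one, one_pow, one_mul,
        Complex.norm_real, Complex.norm_real, Complex.norm_natCast, mul_pow]
      have a1 : ‖Real.cos (ν*θ)‖ ≤ 1 := Real.abs_cos_le_one _
      have a2 : ‖Real.cos θ‖^(2*n+1) ≤ 1 := pow_le_one₀ (norm_nonneg _) (Real.abs_cos_le_one _)
      calc _ ≤ 1 * (‖z‖^(2*n+1) * 1 / ((2*n+1).factorial : ℝ)) := by gcongr
        _ = _ := by ring)
    (Filter.Eventually.of_forall fun θ _ => hsum)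
    (by apply Continuous.intervalIntegrable; fun_prop)
    (Filter.Eventually.of_forall fun θ _ => (Complex.hasSum_sin _).mul_left _)
  refine h1.unique ?_
  refine (congrArg (fun f => HasSum f _) (funext fun n => ?_)).mpr h2
  have e : ∀ θ : ℝ, (Real.cos (ν * θ) : ℂ) * ((-1)^n * (z * (Real.cos θ : ℝ))^(2*n+1) / ((2*n+1).factorial : ℂ)) =
     ((-1)^n * z^(2*n+1) / ((2*n+1).factorial : ℂ)) * ((Real.cos (ν*θ) * Real.cos θ ^ (2*n+1) : ℝ) : ℂ) := by
    intro θ; push_cast; ring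
  simp only [e]
  rw [intervalIntegral.integral_const_mul, intervalIntegral.integral_ofReal, eval_cast, eval_cast]
  have p1 := poch_pos ((3-ν)/2) (by linarith) n
  have p2 := poch_pos ((3+ν)/2) (by linarith) n
  have hm := congrArg (fun x : ℝ => (x:ℂ)) (mom ν n)
  generalize Polynomial.eval ((3-ν)/2) (ascPochhammer ℝ n) = A at *
  generalize Polynomial.eval ((3+ν)/2) (ascPochhammer ℝ n) = B at *
  generalize (∫ θ in (0:ℝ)..(π/2), Real.cos (ν*θ) * Real.cos θ) = I1 at *
  generalize (∫ θ in (0:ℝ)..(π/2), Real.cos (ν*θ) * Real.cos θ ^ (2*n+1)) = In at *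
  have p1' : (A:ℂ) ≠ 0 := by exact_mod_cast p1.ne'
  have p2' : (B:ℂ) ≠ 0 := by exact_mod_cast p2.ne'
  have p3 : ((2*n+1).factorial : ℂ) ≠ 0 := by exact_mod_cast (Nat.factorial_pos _).ne'
  push_cast at hm
  have e4 : (-z^2/4)^n = (-1)^n * z^(2*n) / 4^n := by
    rw [div_pow, neg_pow, pow_mul]
  rw [e4, pow_succ z (2*n)]
  field_simp
  linear_combination -(z^(2*n) * z) * hm

lemma h_diff (ν : ℝ) (h : ℂ → ℂ)
    (hh : ∀ w : ℂ, HasSum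
      (fun n : ℕ => w ^ n /
        ((Polynomial.eval ((((3 - ν) / 2 : ℝ)) : ℂ) (ascPochhammer ℂ n)) *
         (Polynomial.eval ((((3 + ν) / 2 : ℝ)) : ℂ) (ascPochhammer ℂ n))))
      (h w)) (w : ℂ) : DifferentiableAt ℂ h w := by
  have e : h = fun w => ∑' n : ℕ, w ^ n /
        ((Polynomial.eval ((((3 - ν) / 2 : ℝ)) : ℂ) (ascPochhammer ℂ n)) *
         (Polynomial.eval ((((3 + ν) / 2 : ℝ)) : ℂ) (ascPochhammer ℂ n))) := by
    funext w; exact (hh w).tsum_eq.symm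
  have hs := (hh ((‖w‖ + 1 : ℝ) : ℂ)).summable.norm
  rw [e]
  refine (Complex.differentiableOn_tsum_of_summable_norm hs (U := Metric.ball 0 (‖w‖+1)) ?_ Metric.isOpen_ball ?_).differentiableAt
    (Metric.isOpen_ball.mem_nhds (by simp))
  · intro n
    apply Differentiable.differentiableOn
    exact (differentiable_id.pow n).div_const _
  · intro n v hv
    rw [norm_div, norm_div, norm_pow, norm_pow, Complex.norm_real, Real.norm_of_nonneg (by positivity)]
    have : ‖v‖ ≤ ‖w‖ + 1 := by simpa using (mem_ball_zero_iff.mp hv).le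
    gcongr

lemma F_deriv (ν x : ℝ) : HasDerivAt (fun x => ∫ θ in (0:ℝ)..(π/2), Real.cos (ν * θ) * Real.sin (x * Real.cos θ))
    (∫ θ in (0:ℝ)..(π/2), Real.cos (ν * θ) * (Real.cos θ * Real.cos (x * Real.cos θ))) x := by
  refine (intervalIntegral.hasDerivAt_integral_of_dominated_loc_of_deriv_le (𝕜 := ℝ) (s := Set.univ) 
    (bound := fun _ => 1)
    (F := fun x θ => Real.cos (ν * θ) * Real.sin (x * Real.cos θ)) 
    (F' := fun x θ => Real.cos (ν * θ) * (Real.cos θ * Real.cos (x * Real.cos θ)))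
    Filter.univ_mem ?_ ?_ ?_ ?_ ?_ ?_).2
  · refine Filter.Eventually.of_forall fun x => Continuous.aestronglyMeasurable ?_
    fun_prop
  · apply Continuous.intervalIntegrable; fun_prop
  · apply Continuous.aestronglyMeasurable; fun_prop
  · refine Filter.Eventually.of_forall fun θ _ y _ => ?_
    rw [norm_mul, norm_mul]
    have a1 : ‖Real.cos (ν*θ)‖ ≤ 1 := Real.abs_cos_le_one _
    have a2 : ‖Real.cos θ‖ ≤ 1 := Real.abs_cos_le_one _
    have a3 : ‖Real.cos (y * Real.cos θ)‖ ≤ 1 := Real.abs_cos_le_one _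
    exact mul_le_one₀ a1 (by positivity) (mul_le_one₀ a2 (by positivity) a3)
  · apply Continuous.intervalIntegrable; fun_prop
  · refine Filter.Eventually.of_forall fun θ _ y _ => ?_
    have h0 : HasDerivAt (fun y => y * Real.cos θ) (Real.cos θ) y := by
      simpa using (hasDerivAt_id y).mul_const (Real.cos θ)
    refine (h0.sin.const_mul (Real.cos (ν*θ))).congr_deriv ?_
    ring

/-- For `|ν| < 1`, every zero of `h(w) = ₁F₂(1; (3−ν)/2, (3+ν)/2; w)
  = Σ_{n≥0} wⁿ/(((3−ν)/2)ₙ ((3+ν)/2)ₙ)` is a simple negative real zero lying in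
`[−π²(k+1)²/4, −π²k²/4]` for some `k ≥ 1`. -/
theorem zeros_of_hypergeometric_1F2 (ν : ℝ) (hν : |ν| < 1) (h : ℂ → ℂ)
    (hh : ∀ w : ℂ, HasSum
      (fun n : ℕ => w ^ n /
        ((Polynomial.eval ((((3 - ν) / 2 : ℝ)) : ℂ) (ascPochhammer ℂ n)) *
         (Polynomial.eval ((((3 + ν) / 2 : ℝ)) : ℂ) (ascPochhammer ℂ n))))
      (h w)) :
    ∀ w₀ : ℂ, h w₀ = 0 →
      deriv h w₀ ≠ 0 ∧
      ∃ r : ℝ, w₀ = (r : ℂ) ∧ r < 0 ∧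
        ∃ k : ℕ, 1 ≤ k ∧
          -(Real.pi ^ 2 * ((k : ℝ) + 1) ^ 2 / 4) ≤ r ∧ r ≤ -(Real.pi ^ 2 * (k : ℝ) ^ 2 / 4) := by
  intro w₀ hw₀
  obtain ⟨hν1, hν2⟩ := abs_lt.mp hν
  -- choose `z` with `w₀ = -z²/4` and `z.re ≥ 0`
  obtain ⟨z, hz, hzre⟩ : ∃ z : ℂ, w₀ = -z^2/4 ∧ 0 ≤ z.re := by
    obtain ⟨z, hz⟩ := IsAlgClosed.exists_pow_nat_eq (-4*w₀) (n := 2) (by norm_num)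
    rcases le_total 0 z.re with h0 | h0
    · exact ⟨z, by rw [hz]; ring, h0⟩
    · exact ⟨-z, by rw [neg_sq, hz]; ring, by simpa using h0⟩
  have hrep := rep ν hν h hh z
  rw [← hz, hw₀, mul_zero] at hrep
  rcases eq_or_lt_of_le hzre with hx0 | hx0
  · -- `w₀ ≥ 0`
    exfalso
    have e : w₀ = ((z.im^2/4 : ℝ) : ℂ) := by
      have : z = z.im * Complex.I := by apply Complex.ext <;> simp [← hx0]
      rw [hz, this, mul_pow, Complex.I_sq]
      simp
    have hs := hh w₀
    rw [hw₀, e] at hs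
    simp only [eval_cast] at hs
    have hs' : HasSum (fun n : ℕ => (z.im^2/4)^n / (Polynomial.eval ((3-ν)/2) (ascPochhammer ℝ n) * Polynomial.eval ((3+ν)/2) (ascPochhammer ℝ n))) (0:ℝ) := by
      have := Complex.hasSum_iff _ _ |>.mp hs |>.1
      refine (congrArg (fun f => HasSum f (0:ℝ)) (funext fun n => ?_)).mpr this
      norm_cast
    have := le_hasSum hs' 0 (fun n _ => by
      have p1 := poch_pos ((3-ν)/2) (by linarith) n
      have p2 := poch_pos ((3+ν)/2) (by linarith) n
      positivity)
    norm_num at this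
  by_cases hy : z.im = 0
  · -- real case
    set x := z.re with hx
    have hzx : z = (x:ℂ) := by apply Complex.ext <;> simp [hy, hx]
    have hF : ∀ x : ℝ, ((∫ θ in (0:ℝ)..(π/2), Real.cos (ν * θ) * Real.sin (x * Real.cos θ) : ℝ) : ℂ) =
       ((∫ θ in (0:ℝ)..(π/2), Real.cos (ν*θ) * Real.cos θ : ℝ) : ℂ) * x * h (-(x:ℂ)^2/4) := by
      intro x
      rw [rep ν hν h hh x, ← intervalIntegral.integral_ofReal]
      push_cast
      rfl
    have hF0 : (∫ θ in (0:ℝ)..(π/2), Real.cos (ν * θ) * Real.sin (x * Real.cos θ)) = 0 := by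
      have := hF x
      rw [← hzx, ← hz, hw₀, mul_zero] at this
      exact_mod_cast this
    constructor
    · intro hd
      have hI := real_case ν hν x hx0
      have hdh : HasDerivAt h 0 (-(x:ℂ)^2/4) := by
        have := (h_diff ν h hh w₀).hasDerivAt
        rw [hd, hz, hzx] at this
        exact this
      have h0 : HasDerivAt (fun v : ℂ => -v^2/4) (-(2*(x:ℂ))/4) (x:ℂ) := by
        simpa using ((hasDerivAt_id (x:ℂ)).pow 2).neg.div_const 4
      have h1 := (((hasDerivAt_id (x:ℂ)).const_mul ((∫ θ in (0:ℝ)..(π/2), Real.cos (ν*θ) * Real.cos θ : ℝ) : ℂ)).mul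
        (hdh.comp (x:ℂ) h0)).comp_ofReal
      have h2 := (F_deriv ν x).ofReal_comp
      have h3 := h2.unique (h1.congr_of_eventuallyEq (Filter.Eventually.of_forall hF))
      simp only [Function.comp, ← hzx, ← hz, hw₀] at h3
      simp only [mul_zero, zero_mul, add_zero] at h3
      have h4 : (∫ θ in (0:ℝ)..(π/2), Real.cos (ν * θ) * (Real.cos θ * Real.cos (x * Real.cos θ))) = 0 := by
        exact_mod_cast h3
      have e : ∀ θ, Real.cos (ν * θ) * 
        (Real.cos θ * Real.cos (x * Real.cos θ) * Real.sin x - Real.sin (x * Real.cos θ) * Real.cos x) =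
        Real.cos (ν * θ) * (Real.cos θ * Real.cos (x * Real.cos θ)) * Real.sin x - 
         Real.cos (ν * θ) * Real.sin (x * Real.cos θ) * Real.cos x := by intro θ; ring
      simp only [e] at hI
      rw [intervalIntegral.integral_sub, intervalIntegral.integral_mul_const, intervalIntegral.integral_mul_const,
        h4, hF0] at hI
      · simp at hI
      · apply Continuous.intervalIntegrable; fun_prop
      · apply Continuous.intervalIntegrable; fun_prop
    · have hpix : π ≤ x := by
        by_contra hlt
        push Not at hlt
        have : 0 < ∫ θ in (0:ℝ)..(π/2), Real.cos (ν * θ) * Real.sin (x * Real.cos θ) := by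
          apply intervalIntegral.intervalIntegral_pos_of_pos_on
          · apply Continuous.intervalIntegrable
            fun_prop
          · intro t ht
            have h1 := ht.1
            have h2 := ht.2
            have hc : 0 < Real.cos t := Real.cos_pos_of_mem_Ioo ⟨by linarith, by linarith⟩
            have hc1 := Real.cos_le_one t
            exact mul_pos (Real.cos_pos_of_mem_Ioo ⟨by nlinarith, by nlinarith⟩)
              (Real.sin_pos_of_pos_of_lt_pi (by positivity) (by nlinarith))
          · positivity
        linarith
      have hp := Real.pi_pos
      refine ⟨-(x^2/4), ?_, ?_, ⌊x/π⌋₊, ?_, ?_, ?_⟩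
      · rw [hz, hzx]; push_cast; ring
      · have : 0 < x^2/4 := by positivity
        linarith
      · rw [Nat.one_le_floor_iff, le_div_iff₀ hp]; linarith
      · have h1 := (Nat.lt_floor_add_one (x/π)).le
        rw [div_le_iff₀ hp] at h1
        have := pow_le_pow_left₀ hx0.le h1 2
        nlinarith
      · have h1 := Nat.floor_le (a := x/π) (by positivity)
        rw [le_div_iff₀ hp] at h1
        have := pow_le_pow_left₀ (by positivity) h1 2
        nlinarith
  · -- nonreal case
    exfalso
    have hI := complex_case ν hν z hx0.ne' hy
    have hint : IntervalIntegrable (fun θ : ℝ => (Real.cos (ν * θ) : ℂ) * Complex.sin (z * (Real.cos θ : ℝ)) * 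
        (starRingEnd ℂ) (Complex.sin z)) volume 0 (π/2) := by
      apply Continuous.intervalIntegrable; fun_prop
    have h1 := Complex.imCLM.intervalIntegral_comp_comm hint
    rw [intervalIntegral.integral_mul_const, ← hrep, zero_mul, map_zero] at h1
    have e : ∀ θ : ℝ, Real.cos (ν * θ) * 
      (z.re * z.im * (Complex.sin (z * (Real.cos θ : ℝ)) * (starRingEnd ℂ) (Complex.sin z)).im) =
      z.re * z.im * Complex.imCLM ((Real.cos (ν * θ) : ℂ) * Complex.sin (z * (Real.cos θ : ℝ)) * 
        (starRingEnd ℂ) (Complex.sin z)) := by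
      intro θ
      rw [mul_assoc ((Real.cos (ν * θ) : ℝ) : ℂ), Complex.imCLM_apply, Complex.im_ofReal_mul]
      ring
    simp only [e] at hI
    rw [intervalIntegral.integral_const_mul, h1, mul_zero] at hI
    exact lt_irrefl _ hI
end
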